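/- arXiv:2506.09667 — 7 statements merged into one kernel-verified Lean document; each statement's English description precedes it below -/
import Mathlib

section
/- Let G8 be the simple graph on vertex set Fin 8 whose edges are exactly {0,1}, {0,2}, {0,3}, {1,4}, {1,5}, {2,3}, {2,6}, {3,7}, {4,5}, {4,7}, {5,6}, {6,7}. Then G8 is hamiltonian-connected, but there is no path in G8 between the vertices 2 and 3 of length 4 (equivalently, G8 has property P_8 but not property P_5). -/
/-- A graph is hamiltonian-connected if any two distinct vertices are joined by a
hamiltonian path, i.e. a path visiting every vertex. -/
def SimpleGraph.HamiltonianConnected {V : Type*} (G : SimpleGraph V) : Prop :=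
  ∀ u v : V, u ≠ v → ∃ p : G.Walk u v, p.IsPath ∧ ∀ w : V, w ∈ p.support

/-- Property `P k`: between any two distinct vertices there is a path with exactly
`k` vertices, i.e. of length `k - 1`. -/
def SimpleGraph.HasPropP {V : Type*} (G : SimpleGraph V) (k : ℕ) : Prop :=
  ∀ u v : V, u ≠ v → ∃ p : G.Walk u v, p.IsPath ∧ p.length + 1 = k

/-- The smallest counterexample to the Faudree–Schelp conjecture. -/
def G8 : SimpleGraph (Fin 8) :=
  SimpleGraph.fromEdgeSet
    {s(0,1), s(0,2), s(0,3), s(1,4), s(1,5), s(2,3), s(2,6), s(3,7),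
     s(4,5), s(4,7), s(5,6), s(6,7)}

/-- Depth-first search, in the graph with neighbour lists `nbrs`, for a path of length `n` from `u`
to `v` that avoids the vertices in `s`. -/
def pathSearch {V : Type*} [DecidableEq V] (nbrs : V → List V) (v : V) : ℕ → List V → V → Bool
  | 0, s, u => !s.elem u && u == v
  | n + 1, s, u => !s.elem u && (nbrs u).any (pathSearch nbrs v n (u :: s))

theorem pathSearch_iff {V : Type*} [DecidableEq V] {G : SimpleGraph V} {nbrs : V → List V}
    (hG : ∀ u w, G.Adj u w ↔ w ∈ nbrs u) {v : V} (n : ℕ) (s : List V) (u : V) :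
    pathSearch nbrs v n s u = true ↔
      ∃ p : G.Walk u v, p.IsPath ∧ p.length = n ∧ ∀ x ∈ p.support, x ∉ s := by
  induction n generalizing s u with
  | zero =>
    simp only [pathSearch, List.elem_eq_mem, Bool.and_eq_true, Bool.not_eq_true',
      decide_eq_false_iff_not, beq_iff_eq]
    constructor
    · rintro ⟨hu, rfl⟩
      exact ⟨.nil, by simp, rfl, by simpa using hu⟩
    · rintro ⟨p, -, hp, hs⟩
      exact ⟨hs u p.start_mem_support, p.eq_of_length_eq_zero hp⟩
  | succ n ih =>
    simp only [pathSearch, List.elem_eq_mem, Bool.and_eq_true, Bool.not_eq_true',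
      decide_eq_false_iff_not, List.any_eq_true, ih]
    constructor
    · rintro ⟨hu, w, hw, p, hp, hl, hs⟩
      refine ⟨.cons ((hG u w).2 hw) p, ?_, by simp [hl], ?_⟩
      · exact (SimpleGraph.Walk.cons_isPath_iff _ _).2 ⟨hp, fun h => hs u h List.mem_cons_self⟩
      · rintro x hx
        rcases List.mem_cons.1 hx with rfl | hx
        · exact hu
        · exact fun h => hs x hx (List.mem_cons_of_mem _ h)
    · rintro ⟨p, hp, hl, hs⟩
      cases p with
      | nil => simp at hl
      | @cons _ w _ h q =>
        obtain ⟨hq, hu⟩ := (SimpleGraph.Walk.cons_isPath_iff _ _).1 hp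
        refine ⟨hs u (by simp), w, (hG u w).1 h, q, hq, by simpa using hl, fun x hx hxs => ?_⟩
        rcases List.mem_cons.1 hxs with rfl | hxs
        · exact hu hx
        · exact hs x (List.mem_cons_of_mem _ hx) hxs

theorem SimpleGraph.Walk.IsPath.mem_support_of_length_add_one_eq_card {V : Type*} [Fintype V]
    {G : SimpleGraph V} {u v : V} {p : G.Walk u v} (hp : p.IsPath)
    (hl : p.length + 1 = Fintype.card V) (w : V) : w ∈ p.support := by
  classical
  have h : p.support.toFinset = Finset.univ := by
    rw [← Finset.card_eq_iff_eq_univ, List.toFinset_card_of_nodup hp.support_nodup,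
      SimpleGraph.Walk.length_support, hl]
  rw [← List.mem_toFinset, h]
  exact Finset.mem_univ w

/-- The neighbour lists of `G8`. -/
def G8Neighbors (u : Fin 8) : List (Fin 8) :=
  ![[1, 2, 3], [0, 4, 5], [0, 3, 6], [0, 2, 7], [1, 5, 7], [1, 4, 6], [2, 5, 7], [3, 4, 6]] u

theorem G8_adj_iff (u w : Fin 8) : G8.Adj u w ↔ w ∈ G8Neighbors u := by
  simp only [G8, SimpleGraph.fromEdgeSet_adj, Set.mem_insert_iff, Set.mem_singleton_iff]
  revert u w
  decide

theorem G8_hamiltonianConnected_but_no_path_of_length_four :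
    G8.HamiltonianConnected ∧
      ¬ ∃ p : G8.Walk 2 3, p.IsPath ∧ p.length = 4 := by
  constructor
  · intro u v huv
    have h : ∀ u v : Fin 8, u ≠ v → pathSearch G8Neighbors v 7 [] u = true := by decide +kernel
    obtain ⟨p, hp, hl, -⟩ := (pathSearch_iff G8_adj_iff 7 [] u).1 (h u v huv)
    exact ⟨p, hp, hp.mem_support_of_length_add_one_eq_card (by simp [hl])⟩
  · rintro ⟨p, hp, hl⟩
    have h : pathSearch G8Neighbors 3 4 [] 2 = false := by decide +kernel
    simpa [h] using (pathSearch_iff G8_adj_iff 4 [] 2).2 ⟨p, hp, hl, by simp⟩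
end

section
/- Let G8 be the simple graph on vertex set Fin 8 whose edges are exactly {0,1}, {0,2}, {0,3}, {1,4}, {1,5}, {2,3}, {2,6}, {3,7}, {4,5}, {4,7}, {5,6}, {6,7}, and let G8' be the graph obtained from G8 by adding the edge {2,7}. Then G8' is hamiltonian-connected, but there is no path in G8' between the vertices 2 and 3 of length 4. -/
/-- `G8` with the edge `{2,7}` added. -/
def G8' : SimpleGraph (Fin 8) :=
  G8 ⊔ SimpleGraph.fromEdgeSet {s(2,7)}

/-- A duplicate-free list containing every vertex, with consecutive entries adjacent, gives a
hamiltonian path from its first to its last entry. -/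
theorem SimpleGraph.exists_hamiltonian_path_of_isChain {V : Type*} {G : SimpleGraph V} {l : List V}
    {u v : V} (hu : l.head? = some u) (hv : l.getLast? = some v) (hchain : l.IsChain G.Adj)
    (hnodup : l.Nodup) (hmem : ∀ w, w ∈ l) :
    ∃ p : G.Walk u v, p.IsPath ∧ ∀ w : V, w ∈ p.support := by
  have hne : l ≠ [] := List.ne_nil_of_mem (hmem u)
  have hu' : l.head hne = u := by simpa [List.head?_eq_some_head hne] using hu
  have hv' : l.getLast hne = v := by simpa [List.getLast?_eq_some_getLast hne] using hv
  subst hu' hv'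
  refine ⟨.ofSupport l hne hchain, ?_, fun w => ?_⟩
  · rwa [SimpleGraph.Walk.isPath_def, SimpleGraph.Walk.support_ofSupport]
  · rw [SimpleGraph.Walk.support_ofSupport]
    exact hmem w

theorem SimpleGraph.exists_hamiltonian_path_symm {V : Type*} {G : SimpleGraph V} {u v : V}
    (h : ∃ p : G.Walk u v, p.IsPath ∧ ∀ w : V, w ∈ p.support) :
    ∃ p : G.Walk v u, p.IsPath ∧ ∀ w : V, w ∈ p.support := by
  obtain ⟨p, hp, hmem⟩ := h
  exact ⟨p.reverse, hp.reverse, by simpa using hmem⟩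

theorem SimpleGraph.Walk.IsPath.exists_of_length_eq_four {V : Type*} {G : SimpleGraph V} {u v : V}
    {p : G.Walk u v} (hp : p.IsPath) (hlen : p.length = 4) :
    ∃ a b c, G.Adj u a ∧ G.Adj a b ∧ G.Adj b c ∧ G.Adj c v ∧ [u, a, b, c, v].Nodup := by
  match p, hp, hlen with
  | .cons h₁ (.cons h₂ (.cons h₃ (.cons h₄ .nil))), hp, _ =>
    exact ⟨_, _, _, h₁, h₂, h₃, h₄, hp.support_nodup⟩

instance : DecidableRel G8'.Adj := fun a b =>
  decidable_of_iff
    (s(a, b) ∈ ([s(0,1), s(0,2), s(0,3), s(1,4), s(1,5), s(2,3), s(2,6), s(3,7),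
      s(4,5), s(4,7), s(5,6), s(6,7), s(2,7)] : List (Sym2 (Fin 8)))) (by
    revert a b
    simp only [G8', G8, SimpleGraph.sup_adj, SimpleGraph.fromEdgeSet_adj, Set.mem_insert_iff,
      Set.mem_singleton_iff]
    decide)

/-- One hamiltonian path of `G8'` for each pair of distinct vertices. -/
def G8'.hamiltonianPaths : List (List (Fin 8)) :=
  [[0, 2, 3, 7, 6, 5, 4, 1],
   [0, 1, 4, 5, 6, 7, 3, 2],
   [0, 1, 4, 5, 6, 2, 7, 3],
   [0, 1, 5, 6, 2, 3, 7, 4],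
   [0, 1, 4, 7, 3, 2, 6, 5],
   [0, 1, 5, 4, 7, 3, 2, 6],
   [0, 1, 4, 5, 6, 2, 3, 7],
   [1, 0, 3, 7, 4, 5, 6, 2],
   [1, 0, 2, 6, 5, 4, 7, 3],
   [1, 0, 2, 3, 7, 6, 5, 4],
   [1, 0, 3, 2, 6, 7, 4, 5],
   [1, 0, 2, 3, 7, 4, 5, 6],
   [1, 0, 3, 2, 6, 5, 4, 7],
   [2, 0, 1, 4, 5, 6, 7, 3],
   [2, 0, 3, 7, 6, 5, 1, 4],
   [2, 3, 0, 1, 4, 7, 6, 5],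
   [2, 0, 3, 7, 4, 1, 5, 6],
   [2, 3, 0, 1, 4, 5, 6, 7],
   [3, 0, 1, 5, 6, 2, 7, 4],
   [3, 0, 1, 4, 7, 2, 6, 5],
   [3, 0, 1, 5, 4, 7, 2, 6],
   [3, 0, 1, 4, 5, 6, 2, 7],
   [4, 1, 0, 2, 3, 7, 6, 5],
   [4, 5, 1, 0, 2, 3, 7, 6],
   [4, 1, 5, 6, 2, 0, 3, 7],
   [5, 1, 4, 7, 3, 0, 2, 6],
   [5, 4, 1, 0, 3, 2, 6, 7],
   [6, 2, 3, 0, 1, 5, 4, 7]]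

theorem G8'.hamiltonianPaths_spec : ∀ l ∈ G8'.hamiltonianPaths,
    l.IsChain G8'.Adj ∧ l.Nodup ∧ ∀ w, w ∈ l := by
  decide

theorem G8'.exists_mem_hamiltonianPaths : ∀ u v : Fin 8, u < v →
    ∃ l ∈ G8'.hamiltonianPaths, l.head? = some u ∧ l.getLast? = some v := by
  decide

theorem G8'.hamiltonianConnected : G8'.HamiltonianConnected := by
  have key (u v : Fin 8) (h : u < v) :
      ∃ p : G8'.Walk u v, p.IsPath ∧ ∀ w, w ∈ p.support := by
    obtain ⟨l, hl, hu, hv⟩ := G8'.exists_mem_hamiltonianPaths u v h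
    obtain ⟨hchain, hnodup, hmem⟩ := G8'.hamiltonianPaths_spec l hl
    exact SimpleGraph.exists_hamiltonian_path_of_isChain hu hv hchain hnodup hmem
  intro u v huv
  rcases lt_or_gt_of_ne huv with h | h
  · exact key u v h
  · exact SimpleGraph.exists_hamiltonian_path_symm (key v u h)

theorem G8'.not_nodup_of_adj : ∀ a : Fin 8, G8'.Adj 2 a → ∀ b, G8'.Adj a b →
    ∀ c, G8'.Adj b c → G8'.Adj c 3 → ¬ [2, a, b, c, 3].Nodup := by
  decide

theorem G8'_hamiltonianConnected_but_no_path_of_length_four :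
    (G8').HamiltonianConnected ∧
      ¬ ∃ p : (G8').Walk 2 3, p.IsPath ∧ p.length = 4 := by
  refine ⟨G8'.hamiltonianConnected, ?_⟩
  rintro ⟨p, hp, hlen⟩
  obtain ⟨a, b, c, h₁, h₂, h₃, h₄, hnodup⟩ := hp.exists_of_length_eq_four hlen
  exact G8'.not_nodup_of_adj a h₁ b h₂ c h₃ h₄ hnodup
end

section
/- For every hamiltonian-connected simple graph G on n vertices with n ≤ 7, for every pair of distinct vertices u and v of G, and for every integer k with n ≤ 2k and k ≤ n−1, there exists a u–v path in G of length k. (In other words, the Faudree–Schelp conjecture holds for all graphs on at most 7 vertices, so the smallest counterexamples have 8 vertices.) -/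
namespace FaudreeSchelp

/-- Adjacency in a graph on `{0, …, 7}` encoded as a bit mask. -/
def adj (g i j : ℕ) : Bool := g.testBit (8 * i + j)

/-- Add the edge `e` to the graph encoded by `g`. -/
def addEdge (g : ℕ) (e : ℕ × ℕ) : ℕ := g ||| 2 ^ (8 * e.1 + e.2) ||| 2 ^ (8 * e.2 + e.1)

/-- Search for a path with `l` edges from `i` to `t` in the graph `g` on `{0, …, n - 1}`
whose vertices other than `i` avoid the set with bit mask `vis`. -/
def reach (g n t : ℕ) : ℕ → ℕ → ℕ → Bool
  | 0, i, _ => i == t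
  | l + 1, i, vis =>
    (List.range n).any fun j => adj g i j && !vis.testBit j && reach g n t l j (vis ||| 2 ^ j)

/-- Some pair of vertices of `g` is not joined by a hamiltonian path. -/
def notHamConn (g n : ℕ) : Bool :=
  (List.range n).any fun j => (List.range j).any fun i => !reach g n j (n - 1) i (2 ^ i)

/-- Branch over the subsets of a list of edges, using that both the existence of a path with `k`
edges from `0` to `n - 1` and hamiltonian-connectedness are monotone in the graph. -/
def check (n k : ℕ) : List (ℕ × ℕ) → ℕ → Bool
  | [], _ => false
  | e :: es, g =>
    (reach (addEdge g e) n (n - 1) k 0 1 || check n k es (addEdge g e)) &&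
      (notHamConn (es.foldl addEdge g) n || check n k es g)

/-- The pairs `i < j < n` with `j ≠ i + 1`, ordered by `j - i`. -/
def chords (n : ℕ) : List (ℕ × ℕ) :=
  (List.range (n - 2)).flatMap fun d => (List.range (n - 2 - d)).map fun i => (i, i + 2 + d)

/-- The pairs `(i, i + 1)` with `i + 1 < n`. -/
def pathEdges (n : ℕ) : List (ℕ × ℕ) := (List.range (n - 1)).map fun i => (i, i + 1)

theorem adj_addEdge (g : ℕ) (e : ℕ × ℕ) (i j : ℕ) :
    adj (addEdge g e) i j = true ↔
      adj g i j = true ∨ 8 * e.1 + e.2 = 8 * i + j ∨ 8 * e.2 + e.1 = 8 * i + j := by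
  simp [adj, addEdge, Nat.testBit_two_pow, or_assoc]

theorem adj_foldl_addEdge (es : List (ℕ × ℕ)) (g i j : ℕ) :
    adj (es.foldl addEdge g) i j = true ↔ adj g i j = true ∨
      ∃ e ∈ es, 8 * e.1 + e.2 = 8 * i + j ∨ 8 * e.2 + e.1 = 8 * i + j := by
  induction es generalizing g with
  | nil => simp
  | cons e es ih => simp [ih, adj_addEdge, or_assoc]

variable {V : Type*} {G : SimpleGraph V} {n : ℕ} {x : ℕ → V}

theorem exists_path_of_reach {g t : ℕ} (hx : Set.InjOn x {i | i < n})
    (hg : ∀ i < n, ∀ j < n, adj g i j = true → G.Adj (x i) (x j)) {l i vis : ℕ} (hi : i < n)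
    (hvis : vis.testBit i = true) (h : reach g n t l i vis = true) :
    ∃ p : G.Walk (x i) (x t), p.IsPath ∧ p.length = l ∧
      ∀ w ∈ p.support, w ≠ x i → ∃ j < n, w = x j ∧ vis.testBit j = false := by
  induction l generalizing i vis with
  | zero =>
    obtain rfl : i = t := by simpa [reach] using h
    exact ⟨.nil, by simp⟩
  | succ l ih =>
    simp only [reach, List.any_eq_true, List.mem_range, Bool.and_eq_true,
      Bool.not_eq_true'] at h
    obtain ⟨j, hj, ⟨hij, hjvis⟩, h⟩ := h
    obtain ⟨p, hp, hl, hs⟩ := ih hj (by simp) h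
    have hs' : ∀ w ∈ p.support, ∃ m < n, w = x m ∧ vis.testBit m = false := fun w hw => by
      by_cases hwj : w = x j
      · exact ⟨j, hj, hwj, hjvis⟩
      · obtain ⟨m, hm, rfl, hmv⟩ := hs w hw hwj
        exact ⟨m, hm, rfl, by simp_all⟩
    refine ⟨.cons (hg i hi j hj hij) p, hp.cons fun hmem => ?_, by simp [hl], ?_⟩
    · obtain ⟨m, hm, him, hmv⟩ := hs' _ hmem
      rw [hx hi hm him] at hvis
      simp_all
    · intro w hw hwi
      rw [SimpleGraph.Walk.support_cons, List.mem_cons] at hw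
      exact hs' w (hw.resolve_left hwi)

theorem reach_of_path {g t : ℕ} (hx : Set.InjOn x {i | i < n}) (hxs : ∀ w, ∃ i < n, x i = w)
    (hg : ∀ i < n, ∀ j < n, G.Adj (x i) (x j) → adj g i j = true) {i vis : ℕ} (hi : i < n)
    (ht : t < n) {a b : V} (p : G.Walk a b) (hp : p.IsPath) (ha : a = x i) (hb : b = x t)
    (hs : ∀ j < n, x j ∈ p.support → j ≠ i → vis.testBit j = false) :
    reach g n t p.length i vis = true := by
  induction p generalizing i vis with
  | nil => simpa [reach] using hx hi ht (ha.symm.trans hb)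
  | @cons a c b hac p ih =>
    obtain ⟨j, hj, rfl⟩ := hxs c
    subst ha
    rw [SimpleGraph.Walk.cons_isPath_iff] at hp
    have hmem : ∀ m, x m ∈ p.support → m ≠ i := by
      rintro m hm rfl
      exact hp.2 hm
    simp only [SimpleGraph.Walk.length_cons, reach, List.any_eq_true, List.mem_range,
      Bool.and_eq_true, Bool.not_eq_true']
    refine ⟨j, hj, ⟨hg i hi j hj hac, hs j hj (by simp) (hmem j (by simp))⟩,
      ih hj hp.1 rfl hb fun m hm hms hmj => ?_⟩
    simp [hs m hm (by simp [hms]) (hmem m hms), Ne.symm hmj]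

theorem notHamConn_eq_false [Fintype V] {g : ℕ} (hG : G.HamiltonianConnected)
    (hn : Fintype.card V = n) (hx : Set.InjOn x {i | i < n}) (hxs : ∀ w, ∃ i < n, x i = w)
    (hg : ∀ i < n, ∀ j < n, G.Adj (x i) (x j) → adj g i j = true) :
    notHamConn g n = false := by
  classical
  simp only [notHamConn, List.any_eq_false, List.mem_range]
  intro j hj hji
  obtain ⟨i, hij, hr⟩ := List.any_eq_true.1 hji
  rw [List.mem_range] at hij
  have hi := hij.trans hj
  obtain ⟨p, hp, hps⟩ := hG (x i) (x j) fun h => hij.ne (hx hi hj h)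
  have hr' := reach_of_path hx hxs hg hi hj p hp rfl rfl (vis := 2 ^ i)
    fun m _ _ hmi => by simp [Ne.symm hmi]
  rw [(hp.isHamiltonian_of_mem hps).length_eq, hn] at hr'
  simp [hr'] at hr

theorem exists_path_of_check [Fintype V] {k : ℕ} (hG : G.HamiltonianConnected)
    (hn : Fintype.card V = n) (hn0 : 0 < n) (hn8 : n ≤ 8)
    (hx : Set.InjOn x {i | i < n}) (hxs : ∀ w, ∃ i < n, x i = w) (es : List (ℕ × ℕ)) (g : ℕ)
    (hes : ∀ e ∈ es, e.1 < n ∧ e.2 < n)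
    (hlow : ∀ i < n, ∀ j < n, adj g i j = true → G.Adj (x i) (x j))
    (hup : ∀ i < n, ∀ j < n, G.Adj (x i) (x j) → adj (es.foldl addEdge g) i j = true)
    (h : check n k es g = true) :
    ∃ p : G.Walk (x 0) (x (n - 1)), p.IsPath ∧ p.length = k := by
  induction es generalizing g with
  | nil => simp [check] at h
  | cons e es ih =>
    have hes' : ∀ e ∈ es, e.1 < n ∧ e.2 < n := fun e he => hes e (List.mem_cons_of_mem _ he)
    obtain ⟨he₁, he₂⟩ := hes e List.mem_cons_self
    simp only [check, Bool.and_eq_true, Bool.or_eq_true] at h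
    by_cases he : G.Adj (x e.1) (x e.2)
    · have hlow' : ∀ i < n, ∀ j < n, adj (addEdge g e) i j = true → G.Adj (x i) (x j) := by
        intro i hi j hj hij
        rcases (adj_addEdge g e i j).1 hij with hij | hij | hij
        · exact hlow i hi j hj hij
        · obtain ⟨rfl, rfl⟩ : e.1 = i ∧ e.2 = j := by omega
          exact he
        · obtain ⟨rfl, rfl⟩ : e.2 = i ∧ e.1 = j := by omega
          exact he.symm
      rcases h.1 with h | h
      · obtain ⟨p, hp, hl, -⟩ := exists_path_of_reach hx hlow' hn0 (by simp) h
        exact ⟨p, hp, hl⟩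
      · exact ih _ hes' hlow' hup h
    · have hup' : ∀ i < n, ∀ j < n,
          G.Adj (x i) (x j) → adj (es.foldl addEdge g) i j = true := by
        intro i hi j hj hij
        have := hup i hi j hj hij
        rw [adj_foldl_addEdge] at this ⊢
        rcases this with hg | ⟨f, hf, hfij⟩
        · exact .inl hg
        · obtain rfl | hf := List.mem_cons.1 hf
          · refine absurd ?_ he
            rcases hfij with hfij | hfij
            · obtain ⟨rfl, rfl⟩ : f.1 = i ∧ f.2 = j := by omega
              exact hij
            · obtain ⟨rfl, rfl⟩ : f.2 = i ∧ f.1 = j := by omega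
              exact hij.symm
          · exact .inr ⟨f, hf, hfij⟩
      rw [notHamConn_eq_false hG hn hx hxs hup'] at h
      exact ih g hes' hlow hup' (by simpa using h.2)

theorem exists_path_of_check_pathEdges [Fintype V] {k : ℕ} {es : List (ℕ × ℕ)} {u v : V}
    (hG : G.HamiltonianConnected) (hn : Fintype.card V = n) (hn0 : 0 < n) (hn8 : n ≤ 8)
    (huv : u ≠ v) (hes : ∀ e ∈ es, e.1 < n ∧ e.2 < n)
    (hpath : ∀ i < n, ∀ j < n,
      adj ((pathEdges n).foldl addEdge 0) i j = true → i + 1 = j ∨ j + 1 = i)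
    (hfull : ∀ i < n, ∀ j < n, i ≠ j →
      adj (es.foldl addEdge ((pathEdges n).foldl addEdge 0)) i j = true)
    (h : check n k es ((pathEdges n).foldl addEdge 0) = true) :
    ∃ p : G.Walk u v, p.IsPath ∧ p.length = k := by
  classical
  obtain ⟨q, hq, hqs⟩ := hG u v huv
  have hlen := (hq.isHamiltonian_of_mem hqs).length_eq
  have hadj : ∀ i, i + 1 < n → G.Adj (q.getVert i) (q.getVert (i + 1)) := fun i hi =>
    q.adj_getVert_succ (by omega)
  have hx : Set.InjOn q.getVert {i | i < n} := hq.getVert_injOn.mono fun i hi => by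
    simp only [Set.mem_ofPred_eq] at hi ⊢
    omega
  have hxs : ∀ w, ∃ i < n, q.getVert i = w := fun w => by
    obtain ⟨i, rfl, hi⟩ := SimpleGraph.Walk.mem_support_iff_exists_getVert.1 (hqs w)
    exact ⟨i, by omega, rfl⟩
  obtain ⟨p, hp, hl⟩ := exists_path_of_check hG hn hn0 hn8 hx hxs es _ hes
    (fun i hi j hj hij => by
      rcases hpath i hi j hj hij with rfl | rfl
      · exact hadj i hj
      · exact (hadj j hi).symm)
    (fun i hi j hj hij => hfull i hi j hj fun h => hij.ne (by rw [h])) h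
  exact ⟨p.copy q.getVert_zero (by rw [← hn, ← hlen, q.getVert_length]), by simpa, by simpa⟩

end FaudreeSchelp

open FaudreeSchelp in
/-- The Faudree–Schelp conjecture holds for all graphs on at most 7 vertices. -/
theorem faudree_schelp_up_to_seven_vertices
    (V : Type*) [Fintype V] (G : SimpleGraph V)
    (hcard : Fintype.card V ≤ 7)
    (hG : G.HamiltonianConnected)
    (u v : V) (huv : u ≠ v)
    (k : ℕ) (hk₁ : Fintype.card V ≤ 2 * k) (hk₂ : k ≤ Fintype.card V - 1) :
    ∃ p : G.Walk u v, p.IsPath ∧ p.length = k := by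
  classical
  rcases hk₂.eq_or_lt with rfl | hk
  · obtain ⟨p, hp, hps⟩ := hG u v huv
    exact ⟨p, hp, (hp.isHamiltonian_of_mem hps).length_eq⟩
  have reduce {n : ℕ} (es : List (ℕ × ℕ)) (hn : Fintype.card V = n) :=
    exists_path_of_check_pathEdges (k := k) (es := es) hG hn (by omega) (by omega) huv
  obtain ⟨h, rfl⟩ | ⟨h, rfl⟩ | ⟨h, rfl⟩ | ⟨h, rfl⟩ | ⟨h, rfl⟩ | ⟨h, rfl⟩ :
      Fintype.card V = 4 ∧ k = 2 ∨ Fintype.card V = 5 ∧ k = 3 ∨ Fintype.card V = 6 ∧ k = 3 ∨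
      Fintype.card V = 6 ∧ k = 4 ∨ Fintype.card V = 7 ∧ k = 4 ∨ Fintype.card V = 7 ∧ k = 5 := by
    omega
  · apply reduce (chords 4) h <;> decide +kernel
  · apply reduce (chords 5) h <;> decide +kernel
  · apply reduce (chords 6) h <;> decide +kernel
  · apply reduce (chords 6) h <;> decide +kernel
  · apply reduce [(2, 5), (3, 6), (1, 4), (0, 3), (1, 3), (3, 5), (0, 4), (4, 6),
    (2, 4), (2, 6), (0, 2), (1, 6), (0, 5), (1, 5), (0, 6)] h <;> decide +kernel
  · apply reduce [(3, 5), (2, 4), (1, 3), (0, 2), (4, 6), (0, 4), (2, 5), (2, 6),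
    (1, 4), (0, 5), (1, 5), (0, 6), (3, 6), (0, 3), (1, 6)] h <;> decide +kernel
end

section
/- Let G be a 3-regular simple graph and let a, b, c, d, e, f, g be seven distinct vertices of G such that the subgraph of G induced on {a, b, c, d, e, f, g} has edge set exactly {ab, ac, bc, af, be, cd, de, dg, fg}. Let G' be the graph obtained from G by deleting the edges ac and bc, adding six new vertices a', a'', b', b'', c', c'', and adding the edges aa', a'c, a'a'', a''b'', a''c'', b''c'', b'b'', b'c', b'b, c'c'', c'c. If G is hamiltonian-connected, then G' is hamiltonian-connected. -/
/-- The expansion operation of the paper: delete the edges `ac` and `bc` of `G`,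
add six new vertices `a′ = .inr 0`, `a″ = .inr 1`, `b′ = .inr 2`, `b″ = .inr 3`,
`c′ = .inr 4`, `c″ = .inr 5`, and add the edges
`aa′, a′c, a′a″, a″b″, a″c″, b″c″, b′b″, b′c′, b′b, c′c″, c′c`. -/
def expandGraph {V : Type*} (G : SimpleGraph V) (a b c : V) : SimpleGraph (V ⊕ Fin 6) :=
  SimpleGraph.fromEdgeSet
    ((Set.image (Sym2.map Sum.inl) ((G.edgeSet \ {s(a,c), s(b,c)}) : Set (Sym2 V))) ∪
     {s(.inl a, .inr 0), s(.inr 0, .inl c), s(.inr 0, .inr 1),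
      s(.inr 1, .inr 3), s(.inr 1, .inr 5), s(.inr 3, .inr 5),
      s(.inr 2, .inr 3), s(.inr 2, .inr 4), s(.inr 2, .inl b),
      s(.inr 4, .inr 5), s(.inr 4, .inl c)})

namespace SimpleGraph

variable {V : Type*} {G : SimpleGraph V}

/-- The vertex list `l` traces a hamiltonian path of `G` from `u` to `v`. -/
structure IsHamiltonianList (G : SimpleGraph V) (u v : V) (l : List V) : Prop where
  head : l.head? = some u
  last : l.getLast? = some v
  chain : l.IsChain G.Adj
  nodup : l.Nodup
  mem (w : V) : w ∈ l

theorem IsHamiltonianList.reverse {u v : V} {l : List V} (h : G.IsHamiltonianList u v l) :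
    G.IsHamiltonianList v u l.reverse where
  head := by simpa using h.last
  last := by simpa using h.head
  chain := by simpa [List.isChain_reverse, G.adj_comm] using h.chain
  nodup := by simpa using h.nodup
  mem w := by simpa using h.mem w

theorem hamiltonianConnected_iff :
    G.HamiltonianConnected ↔ ∀ u v : V, u ≠ v → ∃ l, G.IsHamiltonianList u v l := by
  refine forall₃_congr fun u v _ => ⟨?_, ?_⟩
  · rintro ⟨p, hp, hmem⟩
    exact ⟨p.support, by simp [List.head?_eq_some_head p.support_ne_nil],
      by simp [List.getLast?_eq_some_getLast p.support_ne_nil],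
      p.isChain_adj_support, hp.support_nodup, hmem⟩
  · rintro ⟨l, h⟩
    have hne : l ≠ [] := List.ne_nil_of_mem (h.mem u)
    have hu : l.head hne = u := by simpa [List.head?_eq_some_head hne] using h.head
    have hv : l.getLast hne = v := by simpa [List.getLast?_eq_some_getLast hne] using h.last
    subst hu hv
    exact ⟨Walk.ofSupport l hne h.chain,
      by simpa [Walk.isPath_def, Walk.support_ofSupport] using h.nodup,
      by simpa [Walk.support_ofSupport] using h.mem⟩

end SimpleGraph

/-- Adjacency inside the core `a, b, c, d, e, f, g`, numbered `0, …, 6`. -/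
def coreNbrs : Fin 7 → List (Fin 7) :=
  ![[1, 2, 5], [0, 2, 4], [0, 1, 3], [2, 4, 6], [1, 3], [0, 6], [3, 5]]

/-- `φ` embeds the core as an induced subgraph of the cubic graph `G`. -/
structure IsCore {V : Type*} (G : SimpleGraph V) (φ : Fin 7 → V) : Prop where
  inj : Function.Injective φ
  adj_iff (i j : Fin 7) : G.Adj (φ i) (φ j) ↔ j ∈ coreNbrs i
  reg (v : V) : (G.neighborSet v).ncard = 3

/-- A nonempty path in `G` from `φ p.1` to `φ p.2`, with interior `L`. -/
def IsDetour {V : Type*} (G : SimpleGraph V) (φ : Fin 7 → V) (p : Fin 7 × Fin 7) (L : List V) :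
    Prop :=
  L ≠ [] ∧ (φ p.1 :: (L ++ [φ p.2])).IsChain G.Adj

/-- The path `l` leaves the core for the last time at `φ e.1` and continues along `Y`; the flag
`e.2` tells whether `Y` is nonempty. -/
def EndsAt {V : Type*} (G : SimpleGraph V) (φ : Fin 7 → V) (l Y : List V) (e : Fin 7 × Bool) :
    Prop :=
  (φ e.1 :: Y).IsChain G.Adj ∧ l.getLast? = (φ e.1 :: Y).getLast? ∧ (e.2 = true ↔ Y ≠ [])

/-- All ways in which a path can continue from the core vertex `x`, having used the core vertices
`vis`; the flag `out` says that `x` was entered from outside the core. A result consists of the core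
vertices used in the end, the pairs of core vertices between which the path runs outside the core,
the last core vertex, and whether the path ends outside the core. -/
def explore : ℕ → List (Fin 7) → Bool → Fin 7 →
    List (List (Fin 7) × List (Fin 7 × Fin 7) × Fin 7 × Bool)
  | 0, _, _, _ => []
  | k + 1, vis, out, x =>
    (vis, [], x, false) ::
    (((coreNbrs x).filter (· ∉ vis)).flatMap fun y => explore k (y :: vis) false y) ++
    if out ∨ x < 4 then [] else
      (vis, [], x, true) ::
      (([4, 5, 6] : List (Fin 7)).filter (· ∉ vis)).flatMap fun y =>
        (explore k (y :: vis) true y).map fun c => (c.1, (x, y) :: c.2.1, c.2.2)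

namespace IsCore

variable {V : Type*} {G : SimpleGraph V} {φ : Fin 7 → V}

theorem card_le (h : IsCore G φ) {i : Fin 7} {s : Finset V}
    (hs : ∀ y ∈ s, G.Adj (φ i) y ∧ y ∉ Set.range φ) :
    s.card + (coreNbrs i).toFinset.card ≤ 3 := by
  classical
  have hdisj : Disjoint s ((coreNbrs i).toFinset.image φ) := by
    rw [Finset.disjoint_left]
    intro y hy hy'
    obtain ⟨j, -, rfl⟩ := Finset.mem_image.1 hy'
    exact (hs _ hy).2 ⟨j, rfl⟩
  rw [← Finset.card_image_of_injective _ h.inj, ← Finset.card_union_of_disjoint hdisj,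
    ← h.reg (φ i), ← Set.ncard_coe_finset]
  refine Set.ncard_le_ncard ?_ (Set.finite_of_ncard_pos (by simp [h.reg]))
  intro y hy
  simp only [Finset.coe_union, Finset.coe_image, List.coe_toFinset, Set.mem_union,
    Finset.mem_coe, Set.mem_image] at hy
  obtain hy | ⟨j, hj, rfl⟩ := hy
  · exact (hs y hy).1
  · exact (h.adj_iff i j).2 hj

theorem four_le (h : IsCore G φ) {i : Fin 7} {y : V} (hadj : G.Adj (φ i) y)
    (hy : y ∉ Set.range φ) : 4 ≤ i := by
  have h₁ := h.card_le (i := i) (s := {y}) (by simpa using ⟨hadj, by simpa using hy⟩)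
  rw [Finset.card_singleton] at h₁
  have h₂ : ∀ i, 1 + (coreNbrs i).toFinset.card ≤ 3 → 4 ≤ i := by decide
  exact h₂ i h₁

theorem outer_unique (h : IsCore G φ) {i : Fin 7} {y z : V} (hadj : G.Adj (φ i) y)
    (hy : y ∉ Set.range φ) (hadj' : G.Adj (φ i) z) (hz : z ∉ Set.range φ) : y = z := by
  classical
  by_contra hne
  have h₁ := h.card_le (i := i) (s := {y, z}) (by
    simp only [Finset.mem_insert, Finset.mem_singleton]
    rintro w (rfl | rfl)
    exacts [⟨hadj, hy⟩, ⟨hadj', hz⟩])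
  rw [Finset.card_pair hne] at h₁
  have h₂ : ∀ i, 2 ≤ (coreNbrs i).toFinset.card := by decide
  have := h₂ i
  omega

theorem exists_explore (h : IsCore G φ) {O : V → Bool} (hO : ∀ v, O v = true ↔ v ∉ Set.range φ)
    (k : ℕ) : ∀ (vis : List (Fin 7)) (out : Bool) (x : Fin 7) (l : List V),
    8 ≤ k + vis.length → vis.Nodup → (∀ i ∈ vis, φ i ∉ l) → (φ x :: l).IsChain G.Adj → l.Nodup →
    (out = true → ∃ y, y ∉ l ∧ y ∉ Set.range φ ∧ G.Adj (φ x) y) →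
    ∃ c ∈ explore k vis out x, (∀ i, i ∈ vis ∨ φ i ∈ l → i ∈ c.1) ∧
      ∃ Ls Y, l.filter O = Ls.flatten ++ Y ∧ List.Forall₂ (IsDetour G φ) c.2.1 Ls ∧
        EndsAt G φ (φ x :: l) Y c.2.2 := by
  induction k with
  | zero =>
    intro vis _ _ _ hk hvis
    have := hvis.length_le_card
    simp at this
    omega
  | succ k ih =>
    intro vis out x l hk hvis hdisj hchain hnd hout
    rcases l with _ | ⟨y, l⟩
    · exact ⟨(vis, [], x, false), by simp [explore], by simp, [], [], by simp [EndsAt]⟩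
    rw [List.isChain_cons_cons] at hchain
    rw [List.nodup_cons] at hnd
    have hnext : ∀ {i : Fin 7} {l' : List V}, φ i ∈ y :: l → l' <:+ l → φ i ∉ l' →
        8 ≤ k + (i :: vis).length ∧ (i :: vis).Nodup ∧ ∀ j ∈ i :: vis, φ j ∉ l' := by
      intro i l' hi hl' hi'
      refine ⟨by simp; omega, List.nodup_cons.2 ⟨fun hv => hdisj i hv hi, hvis⟩, ?_⟩
      rintro j hj
      rcases List.mem_cons.1 hj with rfl | hj
      · exact hi'
      · exact fun hjl => hdisj j hj (List.mem_cons_of_mem _ (hl'.subset hjl))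
    by_cases hy : y ∈ Set.range φ
    · obtain ⟨i, rfl⟩ := hy
      obtain ⟨h₁, h₂, h₃⟩ := hnext (i := i) (l' := l) (by simp) List.suffix_rfl hnd.1
      obtain ⟨c, hc, hcv, Ls, Y, hf, hL, hE⟩ := ih (i :: vis) false i l h₁ h₂ h₃ hchain.2 hnd.2
        (by simp)
      refine ⟨c, ?_, ?_, Ls, Y, ?_, hL, hE.1, ?_, hE.2.2⟩
      · simp only [explore, List.mem_append, List.mem_cons, List.mem_flatMap, List.mem_filter]
        refine .inl (.inr ⟨i, ⟨(h.adj_iff x i).1 hchain.1, ?_⟩, hc⟩)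
        simpa using fun hv => hdisj i hv (by simp)
      · rintro j (hj | hj)
        · exact hcv j (.inl (by simp [hj]))
        · rcases List.mem_cons.1 hj with hj | hj
          · exact hcv j (.inl (by simp [h.inj hj]))
          · exact hcv j (.inr hj)
      · rw [List.filter_cons_of_neg (by simp [hO]), hf]
      · rw [← hE.2.1, List.getLast?_cons_cons]
    · have hx := h.four_le hchain.1 hy
      have hnout : out = false := by
        by_contra ho
        obtain ⟨z, hz, hzr, hadj⟩ := hout (by simpa using ho)
        exact hz (by simp [h.outer_unique hadj hzr hchain.1 hy])
      have hcond : ¬ (out = true ∨ x < 4) := by simp [hnout, hx]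
      have hsplit := List.takeWhile_append_dropWhile (p := O) (l := l)
      set L := l.takeWhile O with hL
      have hLO : ∀ z ∈ L, O z = true := fun z hz => List.mem_takeWhile_imp hz
      have hyO : O y = true := (hO y).2 hy
      rcases hl' : l.dropWhile O with _ | ⟨z, l'⟩
      · rw [hl', List.append_nil] at hsplit
        refine ⟨(vis, [], x, true), ?_, ?_, [], y :: l, ?_, by simp, ?_, by simp, by simp⟩
        · simp only [explore, if_neg hcond, List.mem_append, List.mem_cons]
          simp
        · rintro j (hj | hj)
          · exact hj
          · exfalso
            rcases List.mem_cons.1 hj with rfl | hj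
            · exact hy ⟨j, rfl⟩
            · exact (hO _).1 (hLO _ (hsplit ▸ hj)) ⟨j, rfl⟩
        · rw [← hsplit]
          simpa [List.filter_cons, hyO] using hLO
        · exact List.isChain_cons_cons.2 hchain
      · have hz : z ∈ Set.range φ := by
          by_contra hz
          have := List.head?_dropWhile_not O l
          simp [hl', (hO z).2 hz] at this
        obtain ⟨i, rfl⟩ := hz
        rw [hl'] at hsplit
        have hsuf : φ i :: l' <:+ l := ⟨L, hsplit⟩
        have hnd' := List.nodup_cons.1 (hsuf.sublist.nodup hnd.2)
        obtain ⟨h₁, h₂, h₃⟩ := hnext (i := i) (l' := l')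
          (List.mem_cons_of_mem _ (hsuf.subset (by simp)))
          ((List.suffix_cons _ _).trans hsuf) hnd'.1
        have hch := hchain.2
        rw [← hsplit, ← List.cons_append] at hch
        have hch' := List.isChain_append.1 hch
        have hlast : (y :: L).getLast (by simp) ∉ Set.range φ := by
          rw [← hO]
          have := List.getLast_mem (l := y :: L) (by simp)
          rcases List.mem_cons.1 this with h' | h'
          · rwa [h']
          · exact hLO _ h'
        have hadj : G.Adj (φ i) ((y :: L).getLast (by simp)) :=
          (hch'.2.2 _ (List.getLast_mem_getLast? _) _ (by simp)).symm
        obtain ⟨c, hc, hcv, Ls, Y, hf, hLs, hE⟩ := ih (i :: vis) true i l' h₁ h₂ h₃ hch'.2.1 hnd'.2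
          fun _ => ⟨_, fun hmem => by
            have hdj := List.disjoint_of_nodup_append (l₁ := y :: L) (l₂ := φ i :: l')
              (by rw [List.cons_append, hsplit]; exact List.nodup_cons.2 hnd)
            exact hdj (List.getLast_mem (by simp)) (List.mem_cons_of_mem _ hmem), hlast, hadj⟩
        refine ⟨(c.1, (x, i) :: c.2.1, c.2.2), ?_, ?_, (y :: L) :: Ls, Y, ?_, ?_, hE.1, ?_,
          hE.2.2⟩
        · simp only [explore, if_neg hcond, List.mem_append, List.mem_cons, List.mem_flatMap,
            List.mem_filter, List.mem_map]
          refine .inr (.inr ⟨i, ⟨?_, ?_⟩, c, hc, rfl⟩)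
          · have hmem : ∀ j : Fin 7, 4 ≤ j → j ∈ ([4, 5, 6] : List (Fin 7)) := by decide
            simpa using hmem i (h.four_le hadj hlast)
          · simpa using fun hv => hdisj i hv (List.mem_cons_of_mem _ (hsuf.subset (by simp)))
        · rintro j (hj | hj)
          · exact hcv j (.inl (by simp [hj]))
          · rw [← hsplit] at hj
            simp only [List.mem_cons, List.mem_append] at hj
            rcases hj with rfl | hj | hj | hj
            · exact absurd ⟨j, rfl⟩ hy
            · exact absurd ⟨j, rfl⟩ ((hO _).1 (hLO _ hj))
            · exact hcv j (.inl (by simp [h.inj hj]))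
            · exact hcv j (.inr hj)
        · rw [← hsplit]
          have : L.filter O = L := List.filter_eq_self.2 hLO
          simp [hyO, this, hf, (hO (φ i)).not.2 (by simp)]
        · refine .cons ⟨by simp, ?_⟩ hLs
          rw [List.cons_append, List.isChain_cons_cons]
          refine ⟨hchain.1, ?_⟩
          rw [← List.cons_append, List.isChain_append]
          exact ⟨hch'.1, by simp, by simpa using hch'.2.2⟩
        · rw [← hE.2.1, ← hsplit, ← List.cons_append, ← List.cons_append,
            List.getLast?_append_of_ne_nil _ (by simp)]

end IsCore

/-- Two paths `X`, `Y` which partition the vertices outside the core: `X` is a detour between the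
core vertices in `x` (if any) and `Y` continues a path ending at the core vertex in `y` (if any). -/
structure IsOuterCover {V : Type*} (G : SimpleGraph V) (φ : Fin 7 → V) (x : List (Fin 7 × Fin 7))
    (y : List (Fin 7)) (X Y : List V) : Prop where
  nodup : (X ++ Y).Nodup
  mem_iff (v : V) : v ∈ X ++ Y ↔ v ∉ Set.range φ
  detour : ∀ p ∈ x, IsDetour G φ p X
  tail : ∀ r ∈ y, Y ≠ [] ∧ (φ r :: Y).IsChain G.Adj
  left_eq_nil : x = [] → X = []
  right_eq_nil : y = [] → Y = []

section

variable {V : Type*} {G : SimpleGraph V} {φ : Fin 7 → V}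

theorem IsDetour.reverse {p : Fin 7 × Fin 7} {L : List V} (h : IsDetour G φ p L) :
    IsDetour G φ p.swap L.reverse := by
  refine ⟨by simpa using h.1, ?_⟩
  have hch : (φ p.1 :: (L ++ [φ p.2])).reverse.IsChain G.Adj :=
    List.isChain_reverse.2 (h.2.imp fun _ _ hadj => hadj.symm)
  simpa only [List.reverse_cons, List.reverse_append, List.reverse_nil, List.nil_append,
    List.singleton_append, List.cons_append, Prod.fst_swap, Prod.snd_swap] using hch

theorem IsOuterCover.swap {x : List (Fin 7 × Fin 7)} {y : List (Fin 7)} {X Y : List V}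
    (h : IsOuterCover G φ x y X Y) : IsOuterCover G φ (x.map Prod.swap) y X.reverse Y where
  nodup := by simpa [List.nodup_append] using h.nodup
  mem_iff v := by simpa using h.mem_iff v
  detour := by
    intro p hp
    obtain ⟨q, hq, rfl⟩ := List.mem_map.1 hp
    exact (h.detour q hq).reverse
  tail := h.tail
  left_eq_nil hx := by simpa using h.left_eq_nil (by simpa using hx)
  right_eq_nil := h.right_eq_nil

/-- The ways found by `explore` to traverse the core from `x` to an end `v`. -/
theorem IsCore.exists_route (h : IsCore G φ) (hG : G.HamiltonianConnected) (x : Fin 7) {v : V}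
    (hv : φ x ≠ v) : ∃ c ∈ explore 7 [x] false x, (∀ i, i ∈ c.1) ∧
      (c.2.2.2 = true ↔ v ∉ Set.range φ) ∧ (c.2.2.2 = false → φ c.2.2.1 = v) ∧
      ∃ Ls Y, (Ls.flatten ++ Y).Nodup ∧ (∀ w, w ∈ Ls.flatten ++ Y ↔ w ∉ Set.range φ) ∧
        List.Forall₂ (IsDetour G φ) c.2.1 Ls ∧ (φ c.2.2.1 :: Y).IsChain G.Adj ∧
        (c.2.2.2 = true ↔ Y ≠ []) ∧ (c.2.2.2 = true → Y.getLast? = some v) := by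
  classical
  obtain ⟨l, hl⟩ := SimpleGraph.hamiltonianConnected_iff.1 hG _ _ hv
  rcases l with _ | ⟨w, l⟩
  · simpa using hl.head
  obtain rfl : w = φ x := by simpa using hl.head
  have hnd := List.nodup_cons.1 hl.nodup
  obtain ⟨c, hc, hcv, Ls, Y, hf, hLs, hE⟩ := h.exists_explore
    (O := fun v => decide (v ∉ Set.range φ)) (by simp) 7 [x] false x l (by simp) (by simp)
    (by simpa using hnd.1) hl.chain hnd.2 (by simp)
  have hmem : ∀ w, w ∈ Ls.flatten ++ Y ↔ w ∉ Set.range φ := by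
    intro w
    rw [← hf, List.mem_filter, decide_eq_true_iff, and_iff_right_iff_imp]
    intro hw
    exact (List.mem_cons.1 (hl.mem w)).resolve_left fun hwx => hw ⟨x, hwx.symm⟩
  have hlast := hE.2.1.symm.trans hl.last
  have hfalse : c.2.2.2 = false → φ c.2.2.1 = v := by
    intro hb
    have hY : Y = [] := by simpa [hb] using hE.2.2
    simpa [hY] using hlast
  have htrue : c.2.2.2 = true → Y.getLast? = some v := by
    intro hb
    obtain ⟨y, Y, rfl⟩ := List.exists_cons_of_ne_nil (hE.2.2.1 hb)
    simpa using hlast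
  refine ⟨c, hc, fun i => hcv i ?_, ⟨fun hb => ?_, fun hv => ?_⟩, hfalse, Ls, Y,
    hf ▸ hnd.2.filter _, hmem, hLs, hE.1, hE.2.2, htrue⟩
  · rcases List.mem_cons.1 (hl.mem (φ i)) with hi | hi
    · exact .inl (by simp [h.inj hi])
    · exact .inr hi
  · exact (hmem v).1 (List.mem_append_right _ (List.mem_of_getLast? (htrue hb)))
  · by_contra hb
    exact hv ⟨_, hfalse (by simpa using hb)⟩

theorem explore_zero_six : ∀ c ∈ explore 7 [0] false 0, (∀ i, i ∈ c.1) → c.2.2 = (6, false) →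
    c.2.1 = [(4, 5)] ∨ c.2.1 = [(5, 4)] := by decide +kernel

theorem explore_one_three : ∀ c ∈ explore 7 [1] false 1, (∀ i, i ∈ c.1) → c.2.2 = (3, false) →
    c.2.1 = [(4, 6)] ∨ c.2.1 = [(6, 4)] := by decide +kernel

theorem explore_two_four : ∀ c ∈ explore 7 [2] false 2, (∀ i, i ∈ c.1) → c.2.2 = (4, false) →
    c.2.1 = [] ∨ c.2.1 = [(5, 6)] ∨ c.2.1 = [(6, 5)] := by decide +kernel

/-- The possible traversals of the outside by a path from `b` to a vertex outside the core: the
detour, up to direction, and the last core vertex. -/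
def outerRoutes : List (List (Fin 7 × Fin 7) × Fin 7) :=
  [([], 4), ([], 6), ([(5, 6)], 4), ([(4, 6)], 5), ([(4, 5)], 6)]

theorem explore_one : ∀ c ∈ explore 7 [1] false 1, (∀ i, i ∈ c.1) → c.2.2.2 = true →
    ∃ r ∈ outerRoutes, r.2 = c.2.2.1 ∧ (r.1 = c.2.1 ∨ r.1 = c.2.1.map Prod.swap) := by
  decide +kernel

theorem IsCore.exists_outerCover_of_explore (h : IsCore G φ) (hG : G.HamiltonianConnected)
    {i j : Fin 7} (hij : i ≠ j) {P : List (Fin 7 × Fin 7) → Prop}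
    (hP : ∀ c ∈ explore 7 [i] false i, (∀ k, k ∈ c.1) → c.2.2 = (j, false) → P c.2.1) :
    ∃ x Ls, P x ∧ List.Forall₂ (IsDetour G φ) x Ls ∧ Ls.flatten.Nodup ∧
      ∀ w, w ∈ Ls.flatten ↔ w ∉ Set.range φ := by
  obtain ⟨c, hc, hcv, hv, hfalse, Ls, Y, hnd, hmem, hLs, -, hY, -⟩ :=
    h.exists_route hG i (h.inj.ne hij)
  have hb : c.2.2.2 = false := by simpa using hv
  obtain rfl : Y = [] := by simpa [hb] using hY
  have hj : c.2.2 = (j, false) := Prod.ext (h.inj (hfalse hb)) hb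
  rw [List.append_nil] at hnd hmem
  exact ⟨_, Ls, hP c hc hcv hj, hLs, hnd, hmem⟩

theorem IsOuterCover.of_forall₂ {p : Fin 7 × Fin 7} {Ls : List (List V)}
    (hLs : List.Forall₂ (IsDetour G φ) [p] Ls) (hnd : Ls.flatten.Nodup)
    (hmem : ∀ w, w ∈ Ls.flatten ↔ w ∉ Set.range φ) :
    IsOuterCover G φ [p] [] Ls.flatten [] := by
  obtain ⟨L, _, hL, hnil, rfl⟩ := List.forall₂_cons_left_iff.1 hLs
  obtain rfl := List.forall₂_nil_left_iff.1 hnil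
  exact ⟨by simpa using hnd, by simpa using hmem, by simpa using hL, by simp, by simp, by simp⟩

/-- The ordered pairs of core vertices with neighbours outside the core. -/
def outerPairs : List (Fin 7 × Fin 7) := [(4, 5), (5, 4), (4, 6), (6, 4), (5, 6), (6, 5)]

theorem IsCore.exists_outerCover (h : IsCore G φ) (hG : G.HamiltonianConnected)
    {p : Fin 7 × Fin 7} (hp : p ∈ outerPairs) : ∃ X, IsOuterCover G φ [p] [] X [] := by
  have key : ∀ {q : Fin 7 × Fin 7} {x Ls}, x = [q] ∨ x = [q.swap] →
      List.Forall₂ (IsDetour G φ) x Ls → Ls.flatten.Nodup →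
      (∀ w, w ∈ Ls.flatten ↔ w ∉ Set.range φ) →
      (∃ X, IsOuterCover G φ [q] [] X []) ∧ ∃ X, IsOuterCover G φ [q.swap] [] X [] := by
    rintro q x Ls (rfl | rfl) hLs hnd hmem
    · have := IsOuterCover.of_forall₂ hLs hnd hmem
      exact ⟨⟨_, this⟩, ⟨_, this.swap⟩⟩
    · have := IsOuterCover.of_forall₂ hLs hnd hmem
      exact ⟨⟨_, by simpa using this.swap⟩, ⟨_, this⟩⟩
  obtain ⟨x, Ls, hx, hLs, hnd, hmem⟩ :=
    h.exists_outerCover_of_explore hG (i := 0) (j := 6) (by decide)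
      (P := fun x => x = [(4, 5)] ∨ x = [(5, 4)]) explore_zero_six
  have h45 := key (q := (4, 5)) hx hLs hnd hmem
  obtain ⟨x, Ls, hx, hLs, hnd, hmem⟩ :=
    h.exists_outerCover_of_explore hG (i := 1) (j := 3) (by decide)
      (P := fun x => x = [(4, 6)] ∨ x = [(6, 4)]) explore_one_three
  have h46 := key (q := (4, 6)) hx hLs hnd hmem
  obtain ⟨x, Ls, hx, hLs, hnd, hmem⟩ :=
    h.exists_outerCover_of_explore hG (i := 2) (j := 4) (by decide)
      (P := fun x => x = [] ∨ x = [(5, 6)] ∨ x = [(6, 5)]) explore_two_four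
  have hne : x ≠ [] := by
    rintro rfl
    obtain rfl := List.forall₂_nil_left_iff.1 hLs
    obtain ⟨X, hX⟩ := h45.1
    obtain ⟨w, hw⟩ := List.exists_mem_of_ne_nil _ (hX.detour (4, 5) (by simp)).1
    simpa using (hmem w).2 ((hX.mem_iff w).1 (by simpa using hw))
  have h56 := key (q := (5, 6)) (hx.resolve_left hne) hLs hnd hmem
  simp only [outerPairs, List.mem_cons, List.not_mem_nil, or_false] at hp
  rcases hp with rfl | rfl | rfl | rfl | rfl | rfl
  exacts [h45.1, h45.2, h46.1, h46.2, h56.1, h56.2]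

theorem IsCore.exists_outerCover_tail (h : IsCore G φ) (hG : G.HamiltonianConnected)
    {v : V} (hv : v ∉ Set.range φ) : ∃ r ∈ outerRoutes, ∃ X Y,
      IsOuterCover G φ r.1 [r.2] X Y ∧ Y.getLast? = some v := by
  obtain ⟨c, hc, hcv, hb, -, Ls, Y, hnd, hmem, hLs, hch, hY, hlast⟩ :=
    h.exists_route hG 1 (v := v) fun h' => hv ⟨1, h'⟩
  obtain ⟨r, hr, hrc, hrx⟩ := explore_one c hc hcv (hb.2 hv)
  have hlen : c.2.1.length ≤ 1 := by
    have : ∀ r ∈ outerRoutes, r.1.length ≤ 1 := by decide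
    have := this r hr
    rcases hrx with hrx | hrx <;> simpa [hrx] using this
  have hcov : IsOuterCover G φ c.2.1 [r.2] Ls.flatten Y := by
    refine ⟨hnd, hmem, ?_, by simpa [hrc] using ⟨hY.1 (hb.2 hv), hch⟩, ?_, by simp⟩
    · rintro p hp
      obtain ⟨q, hq⟩ := List.length_eq_one_iff.1
        (le_antisymm hlen (List.length_pos_of_mem hp))
      rw [hq] at hLs hp
      obtain ⟨L, _, hL, hnil, rfl⟩ := List.forall₂_cons_left_iff.1 hLs
      obtain rfl := List.forall₂_nil_left_iff.1 hnil
      obtain rfl := List.mem_singleton.1 hp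
      simpa using hL
    · intro hx
      rw [hx] at hLs
      simp [List.forall₂_nil_left_iff.1 hLs]
  refine ⟨r, hr, ?_⟩
  rcases hrx with hrx | hrx
  · exact ⟨_, Y, hrx ▸ hcov, hlast (hb.2 hv)⟩
  · exact ⟨_, Y, hrx ▸ hcov.swap, hlast (hb.2 hv)⟩

end

/-- The adjacency lists of the expanded core: `0, …, 6` are the core vertices `a, …, g` and
`7, …, 12` the new vertices `a′, a″, b′, b″, c′, c″`. -/
def expandedNbrs : List (List ℕ) :=
  [[1, 5, 7], [0, 4, 9], [3, 7, 11], [2, 4, 6], [1, 3], [0, 6], [3, 5],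
    [0, 2, 8], [7, 10, 12], [1, 10, 11], [8, 9, 12], [2, 9, 12], [8, 10, 11]]

/-- The successors of `i` in the expanded core with two further nodes: `13` stands for the detour
outside the core given by `x`, and `14` for the tail outside the core given by `y`. -/
def successors (x : List (Fin 7 × Fin 7)) (y : List (Fin 7)) (i : ℕ) : List ℕ :=
  expandedNbrs.getD i [] ++
    (x.flatMap fun p => if (p.1 : ℕ) = i then [13] else if i = 13 then [(p.2 : ℕ)] else []) ++
    y.flatMap fun r : Fin 7 => if (r : ℕ) = i then [14] else []

/-- `m` describes a hamiltonian path from `s` to `t`, with the parts outside the core contracted. -/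
def IsPattern (x : List (Fin 7 × Fin 7)) (y : List (Fin 7)) (s t : ℕ) (m : List ℕ) : Prop :=
  m.head? = some s ∧ m.getLast? = some t ∧ m.IsChain (fun i j => j ∈ successors x y i) ∧
    m.Nodup ∧ (∀ i < 13, i ∈ m) ∧ (13 ∈ m ↔ x ≠ []) ∧ (14 ∈ m ↔ y ≠ []) ∧ ∀ i ∈ m, i < 15

instance (x : List (Fin 7 × Fin 7)) (y : List (Fin 7)) (s t : ℕ) (m : List ℕ) :
    Decidable (IsPattern x y s t m) := by
  unfold IsPattern; infer_instance

/-- Depth-first search for a path with `k` steps from `i` to `t` which avoids the set of nodes with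
bit mask `vis`. -/
def search (E : ℕ → List ℕ) (t : ℕ) : ℕ → ℕ → ℕ → Option (List ℕ)
  | 0, _, i => bif i.beq t then some [i] else none
  | k + 1, vis, i => (E i).findSome? fun j =>
      bif vis.testBit j then none else (search E t k (vis ||| 1 <<< j) j).map (i :: ·)

theorem exists_isPattern_of_any {x : List (Fin 7 × Fin 7)} {y : List (Fin 7)} {s t : ℕ}
    {o : Option (List ℕ)} (h : o.any (fun m => IsPattern x y s t m) = true) :
    ∃ m, IsPattern x y s t m := by
  obtain ⟨m, -, hm⟩ := (Option.any_eq_true _ _).1 h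
  exact ⟨m, by simpa using hm⟩

/-- The vertices replacing `c` in the expansion. -/
def gadget : List ℕ := [2, 7, 8, 9, 10, 11, 12]

theorem search_detour : ∀ s ∈ gadget, ∀ t < 13, s ≠ t → ∃ p ∈ outerPairs,
    (search (successors [p] []) t 13 (1 <<< s) s).any (fun m => IsPattern [p] [] s t m) = true := by
  decide +kernel

theorem search_tail : ∀ s ∈ gadget, ∀ r ∈ outerRoutes, ∃ x ∈ [r.1, r.1.map Prod.swap],
    (search (successors x [r.2]) 14 (13 + x.length) (1 <<< s) s).any
      (fun m => IsPattern x [r.2] s 14 m) = true := by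
  decide +kernel

section

variable {V : Type*} {G : SimpleGraph V} {φ : Fin 7 → V}

theorem expandGraph_adj_inl {a b c x y : V} (hxy : G.Adj x y) (h₁ : s(x, y) ≠ s(a, c))
    (h₂ : s(x, y) ≠ s(b, c)) : (expandGraph G a b c).Adj (.inl x) (.inl y) := by
  rw [expandGraph, SimpleGraph.fromEdgeSet_adj]
  refine ⟨.inl ⟨s(x, y), ⟨hxy, by simpa only [Set.mem_insert_iff, Set.mem_singleton_iff, not_or]
    using ⟨h₁, h₂⟩⟩, rfl⟩, by simpa using hxy.ne⟩

theorem isChain_map_inl {a b c : V} {l : List V} (hl : l.IsChain G.Adj) (hc : c ∉ l) :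
    (l.map Sum.inl).IsChain (expandGraph G a b c).Adj := by
  rw [List.isChain_map]
  refine hl.imp_of_mem_imp fun x y hx hy hxy => ?_
  have hxc : x ≠ c := fun h => hc (h ▸ hx)
  have hyc : y ≠ c := fun h => hc (h ▸ hy)
  exact expandGraph_adj_inl hxy (by simp [hxc, hyc]) (by simp [hxc, hyc])

/-- The vertices of the expansion represented by a node of a pattern. -/
def block (φ : Fin 7 → V) (X Y : List V) (i : ℕ) : List (V ⊕ Fin 6) :=
  if h : i < 7 then [.inl (φ ⟨i, h⟩)]
  else if h : i < 13 then [.inr ⟨i - 7, by omega⟩]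
  else if i = 13 then X.map .inl
  else if i = 14 then Y.map .inl
  else []

theorem block_inl (X Y : List V) (i : Fin 7) : block φ X Y i = [.inl (φ i)] := by
  simp [block]

theorem block_inr (X Y : List V) (k : Fin 6) : block φ X Y (k + 7) = [.inr k] := by
  have : (k : ℕ) + 7 < 13 := by omega
  simp [block, this]

theorem exists_block (X Y : List V) {i : ℕ} (hi : i < 13) : ∃ w, block φ X Y i = [w] := by
  unfold block
  split_ifs
  exacts [⟨_, rfl⟩, ⟨_, rfl⟩]

theorem expandedNbrs_core : ∀ i j : Fin 7, (j : ℕ) ∈ expandedNbrs.getD i [] →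
    j ∈ coreNbrs i ∧ s(i, j) ≠ s(0, 2) ∧ s(i, j) ≠ s(1, 2) := by decide

set_option maxHeartbeats 1000000 in
theorem isChain_block_append (h : IsCore G φ) (X Y : List V) {i j : ℕ}
    (hij : j ∈ expandedNbrs.getD i []) :
    (block φ X Y i ++ block φ X Y j).IsChain (expandGraph G (φ 0) (φ 1) (φ 2)).Adj := by
  by_cases hlt : i < 7 ∧ j < 7
  · obtain ⟨hi, hj⟩ := hlt
    lift i to Fin 7 using hi
    lift j to Fin 7 using hj
    obtain ⟨hadj, h₁, h₂⟩ := expandedNbrs_core i j hij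
    have hinj := Sym2.map.injective h.inj
    simpa [block_inl] using
      expandGraph_adj_inl ((h.adj_iff i j).2 hadj) (hinj.ne h₁) (hinj.ne h₂)
  · have hi : i < 13 := by
      by_contra hi
      rw [List.getD_eq_default _ _ (by simp [expandedNbrs]; omega)] at hij
      simp at hij
    interval_cases i <;> simp [expandedNbrs] at hij <;> rcases hij with rfl | rfl | rfl <;>
      first
        | (exfalso; omega)
        | simp [block, expandGraph, SimpleGraph.fromEdgeSet_adj, h.inj.eq_iff]

theorem IsCore.ne_two (h : IsCore G φ) {i : Fin 7} {y : V} {l : List V}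
    (hl : (φ i :: y :: l).IsChain G.Adj) (hy : y ∉ Set.range φ) : φ 2 ≠ φ i := by
  rintro hi
  have := h.four_le (List.isChain_cons_cons.1 hl).1 hy
  rw [← h.inj hi] at this
  exact absurd this (by decide)

theorem IsDetour.two_notMem (h : IsCore G φ) {p : Fin 7 × Fin 7} {L : List V}
    (hL : IsDetour G φ p L) (hout : ∀ v ∈ L, v ∉ Set.range φ) :
    φ 2 ∉ φ p.1 :: (L ++ [φ p.2]) := by
  have hfst : ∀ {p : Fin 7 × Fin 7} {L : List V}, IsDetour G φ p L →
      (∀ v ∈ L, v ∉ Set.range φ) → φ 2 ≠ φ p.1 := by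
    intro p L hL hout
    obtain ⟨y, L, rfl⟩ := List.exists_cons_of_ne_nil hL.1
    exact h.ne_two hL.2 (hout y (by simp))
  have h₁ := hfst hL hout
  have h₂ := hfst hL.reverse (by simpa using hout)
  have h₃ : φ 2 ∉ L := fun hm => hout _ hm ⟨2, rfl⟩
  simpa [h₃] using ⟨h₁, h₂⟩

theorem IsOuterCover.isChain_block_append (h : IsCore G φ) {x : List (Fin 7 × Fin 7)}
    {y : List (Fin 7)} {X Y : List V} (hc : IsOuterCover G φ x y X Y) {i j : ℕ}
    (hij : j ∈ successors x y i) :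
    (block φ X Y i ++ block φ X Y j).IsChain (expandGraph G (φ 0) (φ 1) (φ 2)).Adj := by
  have h13 : block φ X Y 13 = X.map .inl := by simp [block]
  have h14 : block φ X Y 14 = Y.map .inl := by simp [block]
  simp only [successors, List.mem_append, List.mem_flatMap] at hij
  rcases hij with (hij | ⟨p, hp, hij⟩) | ⟨r, hr, hij⟩
  · exact _root_.isChain_block_append h X Y hij
  · have hout : ∀ v ∈ X, v ∉ Set.range φ := fun v hv =>
      (hc.mem_iff v).1 (List.mem_append_left _ hv)
    have hch := isChain_map_inl (a := φ 0) (b := φ 1) (hc.detour p hp).2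
      ((hc.detour p hp).two_notMem h hout)
    simp only [List.map_cons, List.map_append, List.map_nil] at hch
    by_cases hpi : (p.1 : ℕ) = i
    · subst hpi
      obtain rfl : j = 13 := by simpa using hij
      rw [block_inl, h13]
      rw [← List.cons_append] at hch
      exact hch.left_of_append
    · by_cases hi : i = 13
      · subst hi
        obtain rfl : j = p.2 := by simpa [hpi] using hij
        rw [block_inl, h13]
        exact hch.tail
      · simp [hpi, hi] at hij
  · by_cases hri : (r : ℕ) = i
    · subst hri
      obtain rfl : j = 14 := by simpa using hij
      obtain ⟨hne, hch⟩ := hc.tail r hr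
      rw [block_inl, h14]
      have hout : ∀ v ∈ Y, v ∉ Set.range φ := fun v hv =>
        (hc.mem_iff v).1 (List.mem_append_right _ hv)
      have hmem : φ 2 ∉ φ r :: Y := by
        obtain ⟨z, Y, rfl⟩ := List.exists_cons_of_ne_nil hne
        rw [List.mem_cons, not_or]
        exact ⟨h.ne_two hch (hout z (by simp)), fun hm => hout _ hm ⟨2, rfl⟩⟩
      exact isChain_map_inl hch hmem
    · simp [hri] at hij

theorem isChain_flatMap {α β : Type*} {R : β → β → Prop} {S : α → α → Prop} {f : α → List β}
    {m : List α} (hm : m.IsChain S) (hS : ∀ i j, S i j → (f i ++ f j).IsChain R)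
    (hne : ∀ i ∈ m, f i ≠ []) (hR : ∀ i ∈ m, (f i).IsChain R) : (m.flatMap f).IsChain R := by
  rw [List.flatMap_def, List.isChain_flatten (by simpa using hne), List.isChain_map]
  exact ⟨by simpa using hR, hm.imp fun i j hij => (List.isChain_append.1 (hS i j hij)).2.2⟩

theorem IsOuterCover.disjoint_block (h : IsCore G φ) {x : List (Fin 7 × Fin 7)}
    {y : List (Fin 7)} {X Y : List V} (hc : IsOuterCover G φ x y X Y) {i j : ℕ} (hij : i ≠ j) :
    (block φ X Y i).Disjoint (block φ X Y j) := by
  wlog hlt : i < j generalizing i j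
  · exact (this hij.symm (by omega)).symm
  have hX : ∀ i, φ i ∉ X := fun i hi =>
    (hc.mem_iff _).1 (List.mem_append_left _ hi) ⟨i, rfl⟩
  have hY : ∀ i, φ i ∉ Y := fun i hi =>
    (hc.mem_iff _).1 (List.mem_append_right _ hi) ⟨i, rfl⟩
  have hXY := List.disjoint_of_nodup_append hc.nodup
  unfold block
  split_ifs <;> first
    | omega
    | (simp [h.inj.eq_iff, hX, hY]; done)
    | (simp [h.inj.eq_iff]; omega)
    | (intro w hw hw'
       obtain ⟨a, ha, rfl⟩ := List.mem_map.1 hw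
       obtain ⟨b, hb, hba⟩ := List.mem_map.1 hw'
       exact hXY ha (Sum.inl_injective hba ▸ hb))

theorem IsPattern.isHamiltonianList (h : IsCore G φ) {x : List (Fin 7 × Fin 7)}
    {y : List (Fin 7)} {X Y : List V} (hc : IsOuterCover G φ x y X Y) {s t : ℕ} {m : List ℕ}
    (hm : IsPattern x y s t m) {u v : V ⊕ Fin 6} (hu : (block φ X Y s).head? = some u)
    (hv : (block φ X Y t).getLast? = some v) :
    (expandGraph G (φ 0) (φ 1) (φ 2)).IsHamiltonianList u v (m.flatMap (block φ X Y)) := by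
  obtain ⟨hs, ht, hch, hnd, hall, h13, h14, hlt⟩ := hm
  have hb13 : block φ X Y 13 = X.map .inl := by simp [block]
  have hb14 : block φ X Y 14 = Y.map .inl := by simp [block]
  have hne : ∀ i ∈ m, block φ X Y i ≠ [] := by
    intro i hi
    by_cases hi' : i < 13
    · obtain ⟨w, hw⟩ := exists_block (φ := φ) X Y hi'
      simp [hw]
    · have := hlt i hi
      obtain rfl | rfl : i = 13 ∨ i = 14 := by omega
      · obtain ⟨p, hp⟩ := List.exists_mem_of_ne_nil _ (h13.1 hi)
        simpa [hb13] using (hc.detour p hp).1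
      · obtain ⟨r, hr⟩ := List.exists_mem_of_ne_nil _ (h14.1 hi)
        simpa [hb14] using (hc.tail r hr).1
  have hchain : ∀ i, (block φ X Y i).IsChain (expandGraph G (φ 0) (φ 1) (φ 2)).Adj := by
    intro i
    have h2 : φ 2 ∉ X ++ Y := fun hm => (hc.mem_iff _).1 hm ⟨2, rfl⟩
    rw [List.mem_append, not_or] at h2
    unfold block
    split_ifs
    · simp
    · simp
    · rcases x with _ | ⟨p, x⟩
      · simp [hc.left_eq_nil rfl]
      · exact isChain_map_inl (hc.detour p (by simp)).2.tail.left_of_append h2.1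
    · rcases y with _ | ⟨r, y⟩
      · simp [hc.right_eq_nil rfl]
      · exact isChain_map_inl (hc.tail r (by simp)).2.tail h2.2
    · simp
  refine ⟨?_, ?_, isChain_flatMap hch (fun i j => hc.isChain_block_append h) hne
    fun i _ => hchain i, ?_, ?_⟩
  · obtain ⟨m, rfl⟩ := List.head?_eq_some_iff.1 hs
    simp [hu]
  · obtain ⟨m, rfl⟩ := List.getLast?_eq_some_iff.1 ht
    simp [hv]
  · refine List.nodup_flatMap.2 ⟨fun i _ => ?_, hnd.imp fun hij => hc.disjoint_block h hij⟩
    unfold block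
    split_ifs
    · simp
    · simp
    · exact (List.nodup_append.1 hc.nodup).1.map Sum.inl_injective
    · exact (List.nodup_append.1 hc.nodup).2.1.map Sum.inl_injective
    · simp
  · intro w
    rw [List.mem_flatMap]
    rcases w with w | k
    · by_cases hw : w ∈ Set.range φ
      · obtain ⟨i, rfl⟩ := hw
        exact ⟨i, hall _ (by omega), by simp [block_inl]⟩
      · rcases List.mem_append.1 ((hc.mem_iff w).2 hw) with hw | hw
        · refine ⟨13, h13.2 fun hx => ?_, by simpa [hb13] using hw⟩
          simp [hc.left_eq_nil hx] at hw
        · refine ⟨14, h14.2 fun hy => ?_, by simpa [hb14] using hw⟩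
          simp [hc.right_eq_nil hy] at hw
    · exact ⟨k + 7, hall _ (by omega), by simp [block_inr]⟩

/-- A path through the gadget, with interior `P`, which can replace `φ i, φ 2, φ j`. -/
theorem exists_gadget_path (h : IsCore G φ) {i j : Fin 7} (hi : i ∈ coreNbrs 2)
    (hj : j ∈ coreNbrs 2) (hij : i ≠ j) : ∃ P : List (V ⊕ Fin 6),
      (.inl (φ i) :: (P ++ [.inl (φ j)])).IsChain (expandGraph G (φ 0) (φ 1) (φ 2)).Adj ∧
      P.Nodup ∧ ∀ w, w ∈ P ↔ w ∉ Sum.inl '' {v | v ≠ φ 2} := by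
  wlog hlt : i < j generalizing i j
  · obtain ⟨P, hch, hnd, hmem⟩ := this hj hi hij.symm (by omega)
    refine ⟨P.reverse, ?_, by simpa using hnd, by simpa using hmem⟩
    have := List.isChain_reverse.2 (hch.imp fun _ _ hadj => hadj.symm)
    simpa only [List.reverse_cons, List.reverse_append, List.reverse_nil, List.nil_append,
      List.singleton_append, List.cons_append] using this
  have h23 : (expandGraph G (φ 0) (φ 1) (φ 2)).Adj (.inl (φ 2)) (.inl (φ 3)) :=
    (List.isChain_pair).1 (isChain_block_append h [] [] (i := 2) (j := 3) (by decide))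
  have hcov : ∀ P : List (V ⊕ Fin 6), (∀ k, .inr k ∈ P) → .inl (φ 2) ∈ P →
      (∀ v, .inl v ∈ P → v = φ 2) → ∀ w, w ∈ P ↔ w ∉ Sum.inl '' {v | v ≠ φ 2} := by
    rintro P hr hl hu (w | w)
    · by_cases hw : w = φ 2
      · simpa [hw] using hl
      · simpa [hw] using fun hm => hw (hu w hm)
    · simpa using hr w
  have hcases : i = 0 ∧ j = 1 ∨ i = 0 ∧ j = 3 ∨ i = 1 ∧ j = 3 := by
    revert i j; decide
  rcases hcases with ⟨rfl, rfl⟩ | ⟨rfl, rfl⟩ | ⟨rfl, rfl⟩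
  · refine ⟨[.inr 0, .inl (φ 2), .inr 4, .inr 5, .inr 1, .inr 3, .inr 2], ?_, by simp,
      hcov _ (fun k => by fin_cases k <;> simp) (by simp) (by simp)⟩
    simp [expandGraph, SimpleGraph.fromEdgeSet_adj, h.inj.eq_iff]
  · refine ⟨[.inr 0, .inr 1, .inr 5, .inr 3, .inr 2, .inr 4, .inl (φ 2)], ?_, by simp,
      hcov _ (fun k => by fin_cases k <;> simp) (by simp) (by simp)⟩
    simp only [List.cons_append, List.nil_append, List.isChain_cons_cons, h23]
    simp [expandGraph, SimpleGraph.fromEdgeSet_adj, h.inj.eq_iff]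
  · refine ⟨[.inr 2, .inr 4, .inr 5, .inr 3, .inr 1, .inr 0, .inl (φ 2)], ?_, by simp,
      hcov _ (fun k => by fin_cases k <;> simp) (by simp) (by simp)⟩
    simp only [List.cons_append, List.nil_append, List.isChain_cons_cons, h23]
    simp [expandGraph, SimpleGraph.fromEdgeSet_adj, h.inj.eq_iff]

theorem IsCore.exists_of_adj_two (h : IsCore G φ) {v : V} (hv : G.Adj (φ 2) v) :
    ∃ i ∈ coreNbrs 2, φ i = v := by
  by_cases hr : v ∈ Set.range φ
  · obtain ⟨i, rfl⟩ := hr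
    exact ⟨i, (h.adj_iff 2 i).1 hv, rfl⟩
  · exact absurd (h.four_le hv hr) (by decide)

theorem IsCore.exists_isHamiltonianList_inl (h : IsCore G φ) (hG : G.HamiltonianConnected)
    {u v : V} (huv : u ≠ v) (hu : u ≠ φ 2) (hv : v ≠ φ 2) :
    ∃ l, (expandGraph G (φ 0) (φ 1) (φ 2)).IsHamiltonianList (.inl u) (.inl v) l := by
  obtain ⟨l, hl⟩ := SimpleGraph.hamiltonianConnected_iff.1 hG u v huv
  obtain ⟨l₁, l₂, rfl⟩ := List.append_of_mem (hl.mem (φ 2))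
  obtain rfl | ⟨l₁, x, rfl⟩ := List.eq_nil_or_concat' l₁
  · exact absurd (by simpa using hl.head.symm) hu
  rcases l₂ with _ | ⟨y, l₂⟩
  · exact absurd (by simpa using hl.last.symm) hv
  obtain ⟨hc₁, hc₂, hadj⟩ := List.isChain_append.1 hl.chain
  rw [List.isChain_cons_cons] at hc₂
  obtain ⟨i, hi, rfl⟩ := h.exists_of_adj_two (hadj x (by simp) (φ 2) (by simp)).symm
  obtain ⟨j, hj, rfl⟩ := h.exists_of_adj_two hc₂.1
  have hnd := hl.nodup
  simp only [List.nodup_append, List.nodup_cons] at hnd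
  have hn₁ : φ 2 ∉ l₁ ++ [φ i] := fun hm => hnd.2.2 _ hm _ (by simp) rfl
  have hn₂ : φ 2 ∉ φ j :: l₂ := hnd.2.1.1
  have hij : i ≠ j := by
    rintro rfl
    exact hnd.2.2 (φ i) (by simp) (φ i) (by simp) rfl
  obtain ⟨P, hP, hPnd, hPmem⟩ := exists_gadget_path h hi hj hij
  refine ⟨l₁.map .inl ++ .inl (φ i) :: (P ++ .inl (φ j) :: l₂.map .inl), ?_, ?_, ?_, ?_, ?_⟩
  · have := hl.head
    rcases l₁ with _ | ⟨z, l₁⟩ <;> simpa using this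
  · have := hl.last
    rw [List.append_cons, List.getLast?_append_of_ne_nil _ (by simp)] at this
    rw [← List.cons_append, ← List.append_assoc, ← List.map_cons,
      List.getLast?_append_of_ne_nil _ (by simp), List.getLast?_map, this, Option.map_some]
  · have := isChain_map_inl (a := φ 0) (b := φ 1) hc₁ hn₁
    refine List.isChain_split.2
      ⟨by simpa only [List.map_append, List.map_cons, List.map_nil] using this, ?_⟩
    rw [← List.cons_append]
    exact List.isChain_split.2 ⟨hP, isChain_map_inl hc₂.2 hn₂⟩
  · rw [List.append_cons, (List.perm_append_comm_assoc _ _ _).nodup_iff, List.nodup_append]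
    have hmap : l₁.map .inl ++ [.inl (φ i)] ++ .inl (φ j) :: l₂.map .inl =
        (l₁ ++ [φ i] ++ φ j :: l₂).map (.inl : V → V ⊕ Fin 6) := by simp
    rw [hmap]
    refine ⟨hPnd, (hl.nodup.sublist (by simp)).map Sum.inl_injective, ?_⟩
    rintro w hw _ hw' rfl
    obtain ⟨z, hz, rfl⟩ := List.mem_map.1 hw'
    refine (hPmem _).1 hw ⟨z, ?_, rfl⟩
    rintro rfl
    exact (List.mem_append.1 hz).elim hn₁ hn₂
  · rintro (w | k)
    · by_cases hw : w = φ 2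
      · have : .inl w ∈ P := (hPmem _).2 (by simp [hw])
        simp [this]
      · have := hl.mem w
        simp only [List.mem_append, List.mem_cons, List.not_mem_nil, hw, false_or, or_false] at this
        rcases this with (hm | rfl) | rfl | hm <;> simp [*]
    · have : .inr k ∈ P := (hPmem _).2 (by simp)
      simp [this]

theorem IsCore.exists_isHamiltonianList_of_gadget (h : IsCore G φ) (hG : G.HamiltonianConnected)
    {s : ℕ} (hs : s ∈ gadget) {u v : V ⊕ Fin 6} (hu : block φ [] [] s = [u]) (huv : u ≠ v) :
    ∃ l, (expandGraph G (φ 0) (φ 1) (φ 2)).IsHamiltonianList u v l := by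
  have hs13 : s < 13 := (by decide : ∀ s ∈ gadget, s < 13) s hs
  have hblock : ∀ X Y, ∀ i < 13, block φ X Y i = block φ [] [] i := by
    intro X Y i hi
    unfold block
    split_ifs <;> rfl
  by_cases hv : v ∈ Sum.inl '' (Set.range φ)ᶜ
  · obtain ⟨w, hw, rfl⟩ := hv
    obtain ⟨r, hr, X, Y, hc, hY⟩ := h.exists_outerCover_tail hG hw
    have key : ∀ {x X}, IsOuterCover G φ x [r.2] X Y →
        (search (successors x [r.2]) 14 (13 + x.length) (1 <<< s) s).any
          (fun m => IsPattern x [r.2] s 14 m) = true →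
        ∃ l, (expandGraph G (φ 0) (φ 1) (φ 2)).IsHamiltonianList u (.inl w) l := by
      intro x X hc hx
      obtain ⟨m, hm⟩ := exists_isPattern_of_any hx
      exact ⟨_, hm.isHamiltonianList h hc (by simp [hblock X Y s hs13, hu])
        (by simp [block, hY])⟩
    obtain ⟨x, hx, hsearch⟩ := search_tail s hs r hr
    simp only [List.mem_cons, List.not_mem_nil, or_false] at hx
    rcases hx with rfl | rfl
    · exact key hc hsearch
    · exact key hc.swap hsearch
  · obtain ⟨t, ht, hvt⟩ : ∃ t < 13, block φ [] [] t = [v] := by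
      rcases v with w | k
      · obtain ⟨i, rfl⟩ : w ∈ Set.range φ := by simpa using hv
        exact ⟨i, by omega, block_inl _ _ i⟩
      · exact ⟨k + 7, by omega, block_inr _ _ k⟩
    have hst : s ≠ t := by
      rintro rfl
      exact huv (by simpa [hu] using hvt)
    obtain ⟨p, hp, hsearch⟩ := search_detour s hs t ht hst
    obtain ⟨X, hc⟩ := h.exists_outerCover hG hp
    obtain ⟨m, hm⟩ := exists_isPattern_of_any hsearch
    exact ⟨_, hm.isHamiltonianList h hc (by simp [hblock X [] s hs13, hu])
      (by simp [hblock X [] t ht, hvt])⟩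

theorem IsCore.hamiltonianConnected_expandGraph (h : IsCore G φ) (hG : G.HamiltonianConnected) :
    (expandGraph G (φ 0) (φ 1) (φ 2)).HamiltonianConnected := by
  rw [SimpleGraph.hamiltonianConnected_iff]
  have hlabel : ∀ u : V ⊕ Fin 6, (∃ w ≠ φ 2, u = .inl w) ∨
      ∃ s ∈ gadget, block φ [] [] s = [u] := by
    rintro (w | k)
    · by_cases hw : w = φ 2
      · exact .inr ⟨2, by decide, by simpa [hw] using block_inl [] [] 2⟩
      · exact .inl ⟨w, hw, rfl⟩
    · refine .inr ⟨k + 7, ?_, block_inr [] [] k⟩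
      revert k
      decide
  intro u v huv
  rcases hlabel u with ⟨u, hu, rfl⟩ | ⟨s, hs, hus⟩
  · rcases hlabel v with ⟨v, hv, rfl⟩ | ⟨t, ht, hvt⟩
    · exact h.exists_isHamiltonianList_inl hG (fun he => huv (he ▸ rfl)) hu hv
    · obtain ⟨l, hl⟩ := h.exists_isHamiltonianList_of_gadget hG ht hvt huv.symm
      exact ⟨_, hl.reverse⟩
  · exact h.exists_isHamiltonianList_of_gadget hG hs hus huv

end

/-- The expansion operation preserves hamiltonian-connectedness. -/
theorem expandGraph_hamiltonianConnected
    {V : Type*} (G : SimpleGraph V) (a b c d e f g : V)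
    (hdist : ([a, b, c, d, e, f, g] : List V).Nodup)
    (hreg : ∀ v : V, (G.neighborSet v).ncard = 3)
    (hind : ∀ x ∈ ({a, b, c, d, e, f, g} : Set V), ∀ y ∈ ({a, b, c, d, e, f, g} : Set V),
      (G.Adj x y ↔ s(x, y) ∈ ({s(a,b), s(a,c), s(b,c), s(a,f), s(b,e),
        s(c,d), s(d,e), s(d,g), s(f,g)} : Set (Sym2 V))))
    (hG : G.HamiltonianConnected) :
    (expandGraph G a b c).HamiltonianConnected := by
  have hinj : Function.Injective ![a, b, c, d, e, f, g] :=
    List.nodup_ofFn.1 (by simpa using hdist)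
  have hcore : IsCore G ![a, b, c, d, e, f, g] := by
    refine ⟨hinj, fun i j => ?_, hreg⟩
    have hmem : ∀ i, ![a, b, c, d, e, f, g] i ∈ ({a, b, c, d, e, f, g} : Set V) := by
      intro i
      fin_cases i <;> simp
    have hset : ({s(a,b), s(a,c), s(b,c), s(a,f), s(b,e), s(c,d), s(d,e), s(d,g), s(f,g)} :
        Set (Sym2 V)) = Sym2.map ![a, b, c, d, e, f, g] ''
          {s(0, 1), s(0, 2), s(1, 2), s(0, 5), s(1, 4), s(2, 3), s(3, 4), s(3, 6), s(5, 6)} := by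
      simp [Set.image_insert_eq]
    rw [hind _ (hmem i) _ (hmem j), hset, ← Sym2.map_mk,
      (Sym2.map.injective hinj).mem_set_image]
    simp only [Set.mem_insert_iff, Set.mem_singleton_iff]
    revert i j
    decide
  exact hcore.hamiltonianConnected_expandGraph hG
end

section
/- Let G be a 3-regular simple graph and let a, b, c, d, e, f, g be seven distinct vertices of G such that the subgraph of G induced on {a, b, c, d, e, f, g} has edge set exactly {ab, ac, bc, af, be, cd, de, dg, fg}. Let G' be the graph obtained from G by deleting the edges ac and bc, adding six new vertices a', a'', b', b'', c', c'', and adding the edges aa', a'c, a'a'', a''b'', a''c'', b''c'', b'b'', b'c', b'b, c'c'', c'c. Let k ≥ 1 be an integer. If there is no a–c path in G whose length is an odd number ℓ with 3 ≤ ℓ ≤ 5+4k, then there is no a''–c'' path in G' whose length is an odd number ℓ with 3 ≤ ℓ ≤ 9+4k. -/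
namespace SimpleGraph

variable {V : Type*} {G : SimpleGraph V} {a b c : V}

lemma Walk.IsPath.length_eq_zero {u : V} {p : G.Walk u u} (hp : p.IsPath) : p.length = 0 :=
  Walk.length_eq_zero_iff.mpr (Walk.isPath_iff_nil.mp hp)

/-- An internal vertex of a path has two distinct neighbors on the path. -/
lemma Walk.IsPath.exists_two_neighbors {u v x : V} {p : G.Walk u v} (hp : p.IsPath)
    (hx : x ∈ p.support) (hxu : x ≠ u) (hxv : x ≠ v) :
    ∃ y ∈ p.support, ∃ z ∈ p.support, y ≠ z ∧ G.Adj x y ∧ G.Adj x z := by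
  obtain ⟨q, r, rfl⟩ := Walk.mem_support_iff_exists_append.mp hx
  have hq : ¬ q.Nil := fun h => hxu h.eq.symm
  have hr : ¬ r.Nil := fun h => hxv h.eq
  have hy := q.adj_penultimate hq
  have hz := r.adj_snd hr
  refine ⟨q.penultimate, by simp, r.snd, by simp, ?_, hy.symm, hz⟩
  intro h
  have h1 : r.snd ∈ q.support := h ▸ q.getVert_mem_support _
  have h2 : r.snd ∈ r.support.tail := r.snd_mem_tail_support hr
  rw [Walk.isPath_def, Walk.support_append] at hp
  exact List.disjoint_of_nodup_append hp h1 h2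

/-- If `G` has no odd `a`–`c` path of length between `3` and `n`, then every odd `a`–`c` path avoiding
the edges `ac` and `bc` is longer than `n`. -/
lemma not_odd_path_deleteEdges {n : ℕ}
    (hG : ∀ p : G.Walk a c, p.IsPath → ¬ (Odd p.length ∧ 3 ≤ p.length ∧ p.length ≤ n))
    (q : (G.deleteEdges {s(a, c), s(b, c)}).Walk a c) (hq : q.IsPath) (hodd : Odd q.length) :
    n < q.length := by
  by_contra! hle
  refine hG (q.mapLe (deleteEdges_le _)) (hq.mapLe _) ⟨by simpa using hodd, ?_, by simpa using hle⟩
  have h1 : q.length ≠ 1 := by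
    intro h
    have := Walk.adj_of_length_eq_one h
    simp at this
  simp only [Walk.length_map, Walk.mapLe]
  grind

/-- Even `a`–`b` paths avoiding the edges `ac` and `bc` extend to odd `a`–`c` paths. -/
lemma not_even_path_deleteEdges_of_degree {n : ℕ} {d : V} (hab : a ≠ b)
    (hac : a ≠ c) (hbc : G.Adj b c) (hNc : ∀ x, G.Adj c x → x = a ∨ x = b ∨ x = d)
    (hG : ∀ p : G.Walk a c, p.IsPath → ¬ (Odd p.length ∧ 3 ≤ p.length ∧ p.length ≤ n + 1))
    (q : (G.deleteEdges {s(a, c), s(b, c)}).Walk a b) (hq : q.IsPath) (heven : Even q.length) :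
    n < q.length := by
  by_contra! hle
  have hc : c ∉ q.support := by
    intro hc
    obtain ⟨y, -, z, -, hyz, hy, hz⟩ := hq.exists_two_neighbors hc hac.symm hbc.ne'
    simp only [deleteEdges_adj, Set.mem_insert_iff, Set.mem_singleton_iff, Sym2.eq_iff] at hy hz
    have := hNc y hy.1
    have := hNc z hz.1
    grind
  have h0 : q.length ≠ 0 := fun h => hab (Walk.eq_of_length_eq_zero h)
  refine hG ((q.mapLe (deleteEdges_le _)).concat hbc) ((hq.mapLe _).concat (by simpa using hc) hbc) ?_
  simp only [Walk.length_concat, Walk.length_map, Walk.mapLe]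
  refine ⟨heven.add_one, ?_, by omega⟩
  grind

/-- Even `b`–`c` paths avoiding the edges `ac` and `bc` yield odd `a`–`c` paths. -/
lemma not_even_path_deleteEdges {n : ℕ} {f : V} (hbc : b ≠ c) (hac : a ≠ c)
    (hab : G.Adj a b) (hNa : ∀ x, G.Adj a x → x = b ∨ x = c ∨ x = f)
    (hG : ∀ p : G.Walk a c, p.IsPath → ¬ (Odd p.length ∧ 3 ≤ p.length ∧ p.length ≤ n + 1))
    (q : (G.deleteEdges {s(a, c), s(b, c)}).Walk b c) (hq : q.IsPath) (heven : Even q.length) :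
    n < q.length := by
  by_contra! hle
  have h0 : q.length ≠ 0 := fun h => hbc (Walk.eq_of_length_eq_zero h)
  by_cases ha : a ∈ q.support
  · cases q with
    | nil => simp at h0
    | @cons _ x _ h q =>
      rw [Walk.cons_isPath_iff] at hq
      simp only [Walk.length_cons] at heven hle
      by_cases hx : x = a
      · subst hx
        have := not_odd_path_deleteEdges hG q hq.1 (by grind)
        omega
      · have ha' : a ∈ q.support := by
          simpa [hab.ne] using ha
        obtain ⟨y, hyq, z, hzq, hyz, hy, hz⟩ := hq.1.exists_two_neighbors ha' (Ne.symm hx) hac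
        simp only [deleteEdges_adj, Set.mem_insert_iff, Set.mem_singleton_iff, Sym2.eq_iff] at hy hz
        have := hNa y hy.1
        have := hNa z hz.1
        grind
  · refine hG (.cons hab (q.mapLe (deleteEdges_le _))) ((hq.mapLe _).cons (by simpa using ha)) ?_
    simp only [Walk.length_cons, Walk.length_map, Walk.mapLe]
    refine ⟨heven.add_one, ?_, by omega⟩
    grind

/-- A path between distinct vertices has a first step. -/
lemma Walk.IsPath.exists_cons {u v : V} {p : G.Walk u v} (hp : p.IsPath) (huv : u ≠ v) :
    ∃ (x : V) (q : G.Walk x v), G.Adj u x ∧ q.IsPath ∧ p.length = q.length + 1 ∧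
      (∀ z ∈ q.support, z ∈ p.support) ∧ u ∉ q.support := by
  cases p with
  | nil => exact absurd rfl huv
  | cons h q =>
    rw [Walk.cons_isPath_iff] at hp
    exact ⟨_, q, h, hp.1, by simp, by simp +contextual, hp.2⟩

end SimpleGraph

open SimpleGraph

section ExpandGraph

variable {V : Type*} {G : SimpleGraph V} {a b c : V}

lemma expandGraph_adj_inl_inl {u v : V} :
    (expandGraph G a b c).Adj (.inl u) (.inl v) ↔
      (G.deleteEdges {s(a, c), s(b, c)}).Adj u v := by
  have key : s((.inl u : V ⊕ Fin 6), .inl v) = Sym2.map .inl s(u, v) := rfl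
  rw [expandGraph, fromEdgeSet_adj, deleteEdges_adj, key, Set.mem_union,
    (Sym2.map.injective Sum.inl_injective).mem_set_image]
  simp
  exact fun h _ _ _ _ => h.ne

lemma expandGraph_adj_inl_inr {u : V} {i : Fin 6} :
    (expandGraph G a b c).Adj (.inl u) (.inr i) ↔
      i = 0 ∧ (u = a ∨ u = c) ∨ i = 2 ∧ u = b ∨ i = 4 ∧ u = c := by
  have h : s((.inl u : V ⊕ Fin 6), .inr i) ∉
      Set.image (Sym2.map Sum.inl) (G.edgeSet \ {s(a, c), s(b, c)}) := by
    rintro ⟨e, -, he⟩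
    induction e with
    | _ x y => simp at he
  rw [expandGraph, fromEdgeSet_adj, Set.mem_union]
  simp [h]
  grind

lemma expandGraph_adj_inr_inr {i j : Fin 6} :
    (expandGraph G a b c).Adj (.inr i) (.inr j) ↔
      s(i, j) ∈ ({s(0, 1), s(1, 3), s(1, 5), s(3, 5), s(2, 3), s(2, 4), s(4, 5)} :
        Finset (Sym2 (Fin 6))) := by
  have h : s((.inr i : V ⊕ Fin 6), .inr j) ∉
      Set.image (Sym2.map Sum.inl) (G.edgeSet \ {s(a, c), s(b, c)}) := by
    rintro ⟨e, -, he⟩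
    induction e with
    | _ x y => simp at he
  rw [expandGraph, fromEdgeSet_adj, Set.mem_union]
  simp [h]
  clear h
  revert i j
  decide

lemma expandGraph_adj_inr {i : Fin 6} {y : V ⊕ Fin 6}
    (h : (expandGraph G a b c).Adj (.inr i) y) :
    (i = 0 → y = .inl a ∨ y = .inl c ∨ y = .inr 1) ∧
    (i = 1 → y = .inr 0 ∨ y = .inr 3 ∨ y = .inr 5) ∧
    (i = 2 → y = .inr 3 ∨ y = .inr 4 ∨ y = .inl b) ∧
    (i = 3 → y = .inr 1 ∨ y = .inr 5 ∨ y = .inr 2) ∧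
    (i = 4 → y = .inr 2 ∨ y = .inr 5 ∨ y = .inl c) ∧
    (i = 5 → y = .inr 1 ∨ y = .inr 3 ∨ y = .inr 4) := by
  rcases y with y | j
  · have := expandGraph_adj_inl_inr.mp h.symm
    grind
  · rw [expandGraph_adj_inr_inr] at h
    simp only [Sum.inr.injEq, reduceCtorEq, false_or, or_false]
    revert i j
    decide

/-- A path of the expanded graph from an old vertex to a new one runs through old vertices
up to a first new vertex. -/
lemma expandGraph_path_exit {x y : V ⊕ Fin 6} (w : (expandGraph G a b c).Walk x y)
    {u : V} {j : Fin 6} (hx : x = .inl u) (hy : y = .inr j) (hw : w.IsPath) :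
    ∃ (v : V) (i : Fin 6) (q : (G.deleteEdges {s(a, c), s(b, c)}).Walk u v)
      (r : (expandGraph G a b c).Walk (.inr i) y),
      (expandGraph G a b c).Adj (.inl v) (.inr i) ∧ q.IsPath ∧ r.IsPath ∧
      w.length = q.length + 1 + r.length ∧
      (∀ z ∈ q.support, .inl z ∈ w.support) ∧ (∀ z ∈ r.support, z ∈ w.support) ∧
      (∀ z ∈ q.support, .inl z ∉ r.support) := by
  induction w generalizing u with
  | nil => simp [hx] at hy
  | @cons x x' y h p ih =>
    subst hx
    rw [Walk.cons_isPath_iff] at hw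
    rcases x' with u' | i
    · obtain ⟨v, i, q, r, hadj, hq, hr, hl, hqs, hrs, hdisj⟩ := ih rfl hy hw.1
      refine ⟨v, i, .cons (expandGraph_adj_inl_inl.mp h) q, r, hadj,
        hq.cons fun hu => hw.2 (hqs _ hu), hr, by simp; omega, ?_, ?_, ?_⟩
      · intro z hz
        simp only [Walk.support_cons, List.mem_cons] at hz ⊢
        rcases hz with rfl | hz
        · exact .inl rfl
        · exact .inr (hqs z hz)
      · intro z hz
        simp [hrs z hz]
      · intro z hz
        simp only [Walk.support_cons, List.mem_cons] at hz
        rcases hz with rfl | hz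
        · exact fun hu => hw.2 (hrs _ hu)
        · exact hdisj z hz
    · exact ⟨u, i, .nil, p, h, .nil, hw.1, by simp; omega, by simp, by simp +contextual,
        by simpa using hw.2⟩

/-- The vertex `c″` can only be entered from `a″`, `b″` or `c′`. -/
lemma expandGraph_mem_of_walk {x : V ⊕ Fin 6}
    (w : (expandGraph G a b c).Walk x (.inr 5)) (hx : x ≠ .inr 5)
    (h1 : .inr 1 ∉ w.support) (h3 : .inr 3 ∉ w.support) : .inr 4 ∈ w.support := by
  obtain ⟨d, hd, hd1, hd2⟩ := w.exists_boundary_dart {.inr 5}ᶜ (by simpa using hx) (by simp)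
  have hmem := w.dart_fst_mem_support_of_mem_darts hd
  have hadj := d.adj.symm
  simp only [Set.mem_compl_iff, Set.mem_singleton_iff, not_not] at hd2
  rw [hd2] at hadj
  have := (expandGraph_adj_inr hadj).2.2.2.2.2 rfl
  grind

/-- The pair `b″, c″` can only be entered from `a″`, `b′` or `c′`. -/
lemma expandGraph_not_walk {x : V ⊕ Fin 6}
    (w : (expandGraph G a b c).Walk x (.inr 5)) (hx : x ≠ .inr 5) (hx3 : x ≠ .inr 3)
    (h1 : .inr 1 ∉ w.support) (h2 : .inr 2 ∉ w.support) (h4 : .inr 4 ∉ w.support) : False := by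
  obtain ⟨d, hd, hd1, hd2⟩ := w.exists_boundary_dart {.inr 3, .inr 5}ᶜ (by simp [hx, hx3]) (by simp)
  have hmem := w.dart_fst_mem_support_of_mem_darts hd
  have hadj := d.adj.symm
  simp only [Set.mem_compl_iff, Set.mem_insert_iff, Set.mem_singleton_iff, not_or]
    at hd1
  rw [Set.notMem_compl_iff, Set.mem_insert_iff, Set.mem_singleton_iff] at hd2
  rcases hd2 with hd2 | hd2 <;> rw [hd2] at hadj
  · have := (expandGraph_adj_inr hadj).2.2.2.1 rfl
    grind
  · have := (expandGraph_adj_inr hadj).2.2.2.2.2 rfl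
    grind

/-- A path from `c′` to `c″` avoiding `a″` and `b″` is the edge `c′c″`. -/
lemma expandGraph_length_of_four {w : (expandGraph G a b c).Walk (.inr 4) (.inr 5)}
    (hw : w.IsPath) (h1 : .inr 1 ∉ w.support) (h3 : .inr 3 ∉ w.support) : w.length = 1 := by
  obtain ⟨x, q, -, hq, hl, hs, h4⟩ := hw.exists_cons (by simp)
  by_cases hx : x = .inr 5
  · subst hx
    simp [hl, hq.length_eq_zero]
  · exact absurd (expandGraph_mem_of_walk q hx (fun h => h1 (hs _ h)) fun h => h3 (hs _ h)) h4

/-- A path from `b″` to `c″` avoiding `a″` and `b′` is the edge `b″c″`. -/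
lemma expandGraph_length_of_three {w : (expandGraph G a b c).Walk (.inr 3) (.inr 5)}
    (hw : w.IsPath) (h1 : .inr 1 ∉ w.support) (h2 : .inr 2 ∉ w.support) : w.length = 1 := by
  obtain ⟨x, q, hadj, hq, hl, hs, -⟩ := hw.exists_cons (by simp)
  obtain rfl | rfl | rfl := (expandGraph_adj_inr hadj).2.2.2.1 rfl
  · exact absurd (hs _ q.start_mem_support) h1
  · simp [hl, hq.length_eq_zero]
  · exact absurd (hs _ q.start_mem_support) h2

/-- A path from `b′` to `c″` avoiding `a″` and `b` has length `2`. -/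
lemma expandGraph_length_of_two {w : (expandGraph G a b c).Walk (.inr 2) (.inr 5)}
    (hw : w.IsPath) (h1 : .inr 1 ∉ w.support) (hb : .inl b ∉ w.support) : w.length = 2 := by
  obtain ⟨x, q, hadj, hq, hl, hs, h2⟩ := hw.exists_cons (by simp)
  obtain rfl | rfl | rfl := (expandGraph_adj_inr hadj).2.2.1 rfl
  · have := expandGraph_length_of_three hq (fun h => h1 (hs _ h)) h2
    omega
  · obtain ⟨y, r, hadj, hr, hl', hs', h4⟩ := hq.exists_cons (by simp)
    obtain rfl | rfl | rfl := (expandGraph_adj_inr hadj).2.2.2.2.1 rfl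
    · exact absurd (hs' _ r.start_mem_support) h2
    · simp [hl, hl', hr.length_eq_zero]
    · exact (expandGraph_not_walk r (by simp) (by simp) (fun h => h1 (hs _ (hs' _ h)))
        (fun h => h2 (hs' _ h)) h4).elim
  · exact absurd (hs _ q.start_mem_support) hb

/-- A path from `c′` to `c″` avoiding `a″` and `c` has length `1` or `3`. -/
lemma expandGraph_length_of_four_of_notMem
    {w : (expandGraph G a b c).Walk (.inr 4) (.inr 5)}
    (hw : w.IsPath) (h1 : .inr 1 ∉ w.support) (hc : .inl c ∉ w.support) :
    w.length = 1 ∨ w.length = 3 := by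
  obtain ⟨x, q, hadj, hq, hl, hs, h4⟩ := hw.exists_cons (by simp)
  obtain rfl | rfl | rfl := (expandGraph_adj_inr hadj).2.2.2.2.1 rfl
  · obtain ⟨y, r, hadj, hr, hl', hs', h2⟩ := hq.exists_cons (by simp)
    obtain rfl | rfl | rfl := (expandGraph_adj_inr hadj).2.2.1 rfl
    · have := expandGraph_length_of_three hr (fun h => h1 (hs _ (hs' _ h))) h2
      omega
    · exact absurd (hs' _ r.start_mem_support) h4
    · exact (expandGraph_not_walk r (by simp) (by simp) (fun h => h1 (hs _ (hs' _ h))) h2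
        (fun h => h4 (hs' _ h))).elim
  · simp [hl, hq.length_eq_zero]
  · exact absurd (hs _ q.start_mem_support) hc

/-- A path to `c″` from an old vertex avoiding `a′` and `a″` leaves the old vertices through
`bb′` or `cc′`. -/
lemma expandGraph_path_of_inl {u : V} {w : (expandGraph G a b c).Walk (.inl u) (.inr 5)}
    (hw : w.IsPath) (h0 : .inr 0 ∉ w.support) (h1 : .inr 1 ∉ w.support) :
    (∃ q : (G.deleteEdges {s(a, c), s(b, c)}).Walk u b, q.IsPath ∧ w.length = q.length + 3) ∨
    ∃ q : (G.deleteEdges {s(a, c), s(b, c)}).Walk u c, q.IsPath ∧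
      (w.length = q.length + 2 ∨ w.length = q.length + 4) := by
  obtain ⟨v, i, q, r, hadj, hq, hr, hl, hqs, hrs, hdisj⟩ := expandGraph_path_exit w rfl rfl hw
  have hdv := hdisj v q.end_mem_support
  rcases expandGraph_adj_inl_inr.mp hadj with ⟨rfl, -⟩ | ⟨rfl, rfl⟩ | ⟨rfl, rfl⟩
  · exact absurd (hrs _ r.start_mem_support) h0
  · have := expandGraph_length_of_two hr (fun h => h1 (hrs _ h)) hdv
    exact .inl ⟨q, hq, by omega⟩
  · have := expandGraph_length_of_four_of_notMem hr (fun h => h1 (hrs _ h)) hdv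
    exact .inr ⟨q, hq, by omega⟩

/-- A path to `c″` from an old vertex avoiding `a″`, `b′` and `b″` leaves the old vertices for the first time
through `aa′` or `cc′`. -/
lemma expandGraph_path_of_inl_of_notMem {u : V}
    {w : (expandGraph G a b c).Walk (.inl u) (.inr 5)}
    (hw : w.IsPath) (h1 : .inr 1 ∉ w.support) (h2 : .inr 2 ∉ w.support)
    (h3 : .inr 3 ∉ w.support) :
    (∃ q : (G.deleteEdges {s(a, c), s(b, c)}).Walk u a, q.IsPath ∧ w.length = q.length + 4) ∨
    ∃ q : (G.deleteEdges {s(a, c), s(b, c)}).Walk u c, q.IsPath ∧ w.length = q.length + 2 := by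
  obtain ⟨v, i, q, r, hadj, hq, hr, hl, hqs, hrs, hdisj⟩ := expandGraph_path_exit w rfl rfl hw
  have hdv := hdisj v q.end_mem_support
  rcases expandGraph_adj_inl_inr.mp hadj with ⟨rfl, hv⟩ | ⟨rfl, rfl⟩ | ⟨rfl, rfl⟩
  · obtain ⟨x, r', hadj', hr', hl', hs', h0⟩ := hr.exists_cons (by simp)
    obtain ⟨x, rfl⟩ : ∃ y, x = .inl y := by
      obtain rfl | rfl | rfl := (expandGraph_adj_inr hadj').1 rfl
      · exact ⟨_, rfl⟩
      · exact ⟨_, rfl⟩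
      · exact absurd (hrs _ (hs' _ r'.start_mem_support)) h1
    obtain ⟨v', i, q', t, hadj'', hq', ht, hl'', hqs', hts, -⟩ :=
      expandGraph_path_exit r' rfl rfl hr'
    rcases expandGraph_adj_inl_inr.mp hadj'' with ⟨rfl, -⟩ | ⟨rfl, -⟩ | ⟨rfl, rfl⟩
    · exact absurd (hts _ t.start_mem_support) h0
    · exact absurd (hrs _ (hs' _ (hts _ t.start_mem_support))) h2
    · have hvc : v ≠ v' := by
        rintro rfl
        exact hdv (hs' _ (hqs' _ q'.end_mem_support))
      obtain rfl : v = a := hv.resolve_right hvc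
      have hxv : x ≠ v := by
        rintro rfl
        exact hdv (hs' _ r'.start_mem_support)
      obtain rfl : x = v' := by
        have := (expandGraph_adj_inr hadj').1 rfl
        simpa [hxv] using this
      have h := expandGraph_length_of_four ht (fun h => h1 (hrs _ (hs' _ (hts _ h))))
        (fun h => h3 (hrs _ (hs' _ (hts _ h))))
      have := hq'.length_eq_zero
      exact .inl ⟨q, hq, by omega⟩
  · exact absurd (hrs _ r.start_mem_support) h2
  · have := expandGraph_length_of_four hr (fun h => h1 (hrs _ h)) (fun h => h3 (hrs _ h))
    exact .inr ⟨q, hq, by omega⟩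

end ExpandGraph

/-- The expansion operation propagates the absence of short odd paths between
`a` and `c` to the absence of short odd paths between `a″` and `c″`. -/
theorem expandGraph_no_short_odd_paths
    {V : Type*} (G : SimpleGraph V) (a b c d e f g : V)
    (hdist : ([a, b, c, d, e, f, g] : List V).Nodup)
    (hreg : ∀ v : V, (G.neighborSet v).ncard = 3)
    (hind : ∀ x ∈ ({a, b, c, d, e, f, g} : Set V), ∀ y ∈ ({a, b, c, d, e, f, g} : Set V),
      (G.Adj x y ↔ s(x, y) ∈ ({s(a,b), s(a,c), s(b,c), s(a,f), s(b,e),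
        s(c,d), s(d,e), s(d,g), s(f,g)} : Set (Sym2 V))))
    (k : ℕ) (hk : 1 ≤ k)
    (hG : ∀ p : G.Walk a c, p.IsPath →
      ¬ (Odd p.length ∧ 3 ≤ p.length ∧ p.length ≤ 5 + 4 * k)) :
    ∀ p : (expandGraph G a b c).Walk (.inr 1) (.inr 5), p.IsPath →
      ¬ (Odd p.length ∧ 3 ≤ p.length ∧ p.length ≤ 9 + 4 * k) := by
  have hN : ∀ x y z w : V, G.Adj x y → G.Adj x z → G.Adj x w → y ≠ z → y ≠ w → z ≠ w →
      ∀ t, G.Adj x t → t = y ∨ t = z ∨ t = w := by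
    intro x y z w hy hz hw hyz hyw hzw t ht
    have hsub : ({y, z, w} : Set V) ⊆ G.neighborSet x := by
      rintro _ (rfl | rfl | rfl) <;> assumption
    have hfin : (G.neighborSet x).Finite := Set.finite_of_ncard_ne_zero (by simp [hreg])
    have hcard : ({y, z, w} : Set V).ncard = 3 := Set.ncard_eq_three.mpr ⟨y, z, w, hyz, hyw, hzw, rfl⟩
    have := Set.eq_of_subset_of_ncard_le hsub (by rw [hreg, hcard]) hfin
    have ht' : t ∈ ({y, z, w} : Set V) := this ▸ ht
    simpa using ht'
  have hab : G.Adj a b := (hind a (by simp) b (by simp)).mpr (by simp)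
  have hac : G.Adj a c := (hind a (by simp) c (by simp)).mpr (by simp)
  have hbc : G.Adj b c := (hind b (by simp) c (by simp)).mpr (by simp)
  have haf : G.Adj a f := (hind a (by simp) f (by simp)).mpr (by simp)
  have hcd : G.Adj c d := (hind c (by simp) d (by simp)).mpr (by simp)
  simp only [List.nodup_cons, List.mem_cons, List.not_mem_nil, not_or] at hdist
  have hNa := hN a b c f hab hac haf (by grind) (by grind) (by grind)
  have hNc := hN c a b d hac.symm hbc.symm hcd (by grind) (by grind) (by grind)
  have hAC := not_odd_path_deleteEdges (b := b) hG
  have hAB := not_even_path_deleteEdges_of_degree (n := 4 + 4 * k) hab.ne hac.ne hbc hNc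
    (by convert hG using 5; omega)
  have hBC := not_even_path_deleteEdges (n := 4 + 4 * k) hbc.ne hac.ne hab hNa
    (by convert hG using 5; omega)
  rintro p hp ⟨hodd, h3, hle⟩
  obtain ⟨x, q, hadj, hq, hl, hs, h1⟩ := hp.exists_cons (by simp)
  obtain rfl | rfl | rfl := (expandGraph_adj_inr hadj).2.1 rfl
  · obtain ⟨y, r, hadj', hr, hl', hs', h0⟩ := hq.exists_cons (by simp)
    have h1' : .inr 1 ∉ r.support := fun h => h1 (hs' _ h)
    obtain rfl | rfl | rfl := (expandGraph_adj_inr hadj').1 rfl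
    · rcases expandGraph_path_of_inl hr h0 h1' with ⟨t, ht, hlt⟩ | ⟨t, ht, hlt⟩
      · have := hAB t ht (by grind)
        omega
      · have := hAC t ht (by grind)
        omega
    · rcases expandGraph_path_of_inl hr h0 h1' with ⟨t, ht, hlt⟩ | ⟨t, ht, hlt⟩
      · have := hBC t.reverse ht.reverse (by rw [Walk.length_reverse]; grind)
        rw [Walk.length_reverse] at this
        omega
      · have := ht.length_eq_zero
        grind
    · exact h1' r.start_mem_support
  · obtain ⟨y, r, hadj', hr, hl', hs', h3'⟩ := hq.exists_cons (by simp)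
    have h1' : .inr 1 ∉ r.support := fun h => h1 (hs' _ h)
    obtain rfl | rfl | rfl := (expandGraph_adj_inr hadj').2.2.2.1 rfl
    · exact h1' r.start_mem_support
    · have := hr.length_eq_zero
      omega
    · obtain ⟨z, t, hadj'', ht, hl'', hs'', h2⟩ := hr.exists_cons (by simp)
      have h1'' : .inr 1 ∉ t.support := fun h => h1' (hs'' _ h)
      have h3'' : .inr 3 ∉ t.support := fun h => h3' (hs'' _ h)
      obtain rfl | rfl | rfl := (expandGraph_adj_inr hadj'').2.2.1 rfl
      · exact h3'' t.start_mem_support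
      · have := expandGraph_length_of_four ht h1'' h3''
        grind
      · rcases expandGraph_path_of_inl_of_notMem ht h1'' h2 h3'' with ⟨m, hm, hlm⟩ | ⟨m, hm, hlm⟩
        · have := hAB m.reverse hm.reverse (by rw [Walk.length_reverse]; grind)
          rw [Walk.length_reverse] at this
          omega
        · have := hBC m hm (by grind)
          omega
  · have := hq.length_eq_zero
    omega
end

section
/- For every natural number k there exists a hamiltonian-connected simple graph G on 16+6k vertices such that, for each even integer i with 4 ≤ i ≤ 10+4k, the graph G does not have property P_i; that is, G fails P_i for a linear number (in the order of the graph) of values of i within the interval conjectured by Faudree and Schelp. -/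
namespace SimpleGraph

variable {V : Type*} {G : SimpleGraph V}

/-- There is a path from `u` to `v` whose vertex set is exactly `S`. -/
def Spans (G : SimpleGraph V) (S : Set V) (u v : V) : Prop :=
  ∃ p : G.Walk u v, p.IsPath ∧ ∀ w, w ∈ p.support ↔ w ∈ S

namespace Spans

theorem singleton (u : V) : G.Spans {u} u u :=
  ⟨.nil, .nil, by simp⟩

theorem symm {S : Set V} {u v : V} (h : G.Spans S u v) : G.Spans S v u := by
  obtain ⟨p, hp, hS⟩ := h
  exact ⟨p.reverse, hp.reverse, by simpa using hS⟩

theorem append {S T : Set V} {u v w z : V} (h₁ : G.Spans S u v) (hadj : G.Adj v w)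
    (h₂ : G.Spans T w z) (hd : ∀ t ∈ S, t ∉ T) : G.Spans (S ∪ T) u z := by
  obtain ⟨p, hp, hS⟩ := h₁
  obtain ⟨q, hq, hT⟩ := h₂
  refine ⟨p.append (.cons hadj q), ?_, ?_⟩
  · rw [Walk.isPath_def, Walk.support_append, Walk.support_cons, List.tail_cons,
      List.nodup_append']
    exact ⟨hp.support_nodup, hq.support_nodup, fun t ht ht' ↦
      hd t ((hS t).1 ht) ((hT t).1 ht')⟩
  · intro t
    rw [Walk.support_append, Walk.support_cons, List.tail_cons, List.mem_append, hS, hT]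
    rfl

theorem congr {S T : Set V} {u v : V} (h : G.Spans S u v) (hST : ∀ w, w ∈ S ↔ w ∈ T) :
    G.Spans T u v := by
  rwa [← Set.ext hST]

theorem map {W : Type*} {H : SimpleGraph W} (e : G ≃g H) {S : Set V} {u v : V}
    (h : G.Spans S u v) : H.Spans (e '' S) (e u) (e v) := by
  obtain ⟨p, hp, hS⟩ := h
  refine ⟨p.map e.toHom, hp.map e.injective, fun w ↦ ?_⟩
  rw [Walk.support_map]
  simp [hS]

end Spans

/-- The layer of a vertex: `{0, 1}`, `{2, 3, 4}`, `{5, 6, 7}`, and so on. -/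
def layer {n : ℕ} (a : Fin n) : ℕ := (a.val + 1) / 3

/-- The graph on the layers `0, …, N` in which consecutive layers are completely joined and
the layers `0` and `N` are cliques. It is used with `n = 3 * N + 1`, so that the layers `0` and
`N` have two vertices and the others three. -/
def layered (n N : ℕ) : SimpleGraph (Fin n) where
  Adj a b := layer a + 1 = layer b ∨ layer b + 1 = layer a ∨
    (a ≠ b ∧ layer a = layer b ∧ (layer a = 0 ∨ layer a = N))
  symm := ⟨fun a b h ↦ by grind⟩
  loopless := ⟨fun a h ↦ by grind⟩

section layered

variable {n N : ℕ}

theorem layered_adj {a b : Fin n} : (layered n N).Adj a b ↔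
    layer a + 1 = layer b ∨ layer b + 1 = layer a ∨
      (a ≠ b ∧ layer a = layer b ∧ (layer a = 0 ∨ layer a = N)) := Iff.rfl

theorem layer_le (hn : n = 3 * N + 1) (a : Fin n) : layer a ≤ N := by
  unfold layer; omega

theorem layer_rev (hn : n = 3 * N + 1) (a : Fin n) : layer a.rev = N - layer a := by
  simp only [layer, Fin.val_rev]; omega

theorem exists_layer_eq_triple (hn : n = 3 * N + 1) {m : ℕ} (h₀ : 0 < m) (h₁ : m < N) :
    ∃ a b c : Fin n, a ≠ b ∧ a ≠ c ∧ b ≠ c ∧ ∀ w, layer w = m ↔ w = a ∨ w = b ∨ w = c := by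
  refine ⟨⟨3 * m - 1, by omega⟩, ⟨3 * m, by omega⟩, ⟨3 * m + 1, by omega⟩, ?_⟩
  simp only [ne_eq, Fin.ext_iff, layer]
  refine ⟨by omega, by omega, by omega, fun w ↦ by omega⟩

theorem exists_layer_eq_triple_of_layer (hn : n = 3 * N + 1) {a : Fin n} {m : ℕ}
    (ha : layer a = m) (h₀ : 0 < m) (h₁ : m < N) :
    ∃ b c : Fin n, a ≠ b ∧ a ≠ c ∧ b ≠ c ∧ ∀ w, layer w = m ↔ w = a ∨ w = b ∨ w = c := by
  obtain ⟨x, y, z, hxy, hxz, hyz, h⟩ := exists_layer_eq_triple hn h₀ h₁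
  rcases (h a).1 ha with rfl | rfl | rfl
  · exact ⟨y, z, by grind⟩
  · exact ⟨x, z, by grind⟩
  · exact ⟨x, y, by grind⟩

theorem exists_layer_eq_triple_of_layer_pair (hn : n = 3 * N + 1) {a b : Fin n} {m : ℕ}
    (ha : layer a = m) (hb : layer b = m) (hab : a ≠ b) (h₀ : 0 < m) (h₁ : m < N) :
    ∃ c : Fin n, a ≠ c ∧ b ≠ c ∧ ∀ w, layer w = m ↔ w = a ∨ w = b ∨ w = c := by
  obtain ⟨y, z, hay, haz, hyz, h⟩ := exists_layer_eq_triple_of_layer hn ha h₀ h₁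
  rcases (h b).1 hb with rfl | rfl | rfl
  · exact absurd rfl hab
  · exact ⟨z, by grind⟩
  · exact ⟨y, by grind⟩

theorem exists_layer_eq_pair (hn : n = 3 * N + 1) {a : Fin n} {m : ℕ} (hN : 0 < N)
    (ha : layer a = m) (hm : m = 0 ∨ m = N) :
    ∃ b : Fin n, a ≠ b ∧ ∀ w, layer w = m ↔ w = a ∨ w = b := by
  by_cases h : a.val = 0 ∨ a.val + 2 = n
  · refine ⟨⟨a.val + 1, by omega⟩, ?_⟩
    simp only [ne_eq, Fin.ext_iff, layer] at *
    exact ⟨by omega, fun w ↦ by omega⟩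
  · refine ⟨⟨a.val - 1, by omega⟩, ?_⟩
    simp only [ne_eq, Fin.ext_iff, layer] at *
    exact ⟨by omega, fun w ↦ by omega⟩

theorem exists_pair_layer_eq (hn : n = 3 * N + 1) (hN : 0 < N) {m : ℕ} (hm : m ≤ N) :
    ∃ s t : Fin n, s ≠ t ∧ layer s = m ∧ layer t = m := by
  rcases Nat.eq_zero_or_pos m with rfl | h
  · refine ⟨⟨0, by omega⟩, ⟨1, by omega⟩, ?_⟩
    simp [layer]
  · refine ⟨⟨3 * m - 1, by omega⟩, ⟨3 * m, by omega⟩, ?_⟩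
    simp only [ne_eq, Fin.ext_iff, layer]
    omega

/-- Reversing the order of the vertices is an automorphism. -/
def layeredRev (hn : n = 3 * N + 1) : layered n N ≃g layered n N where
  toEquiv := Fin.revPerm
  map_rel_iff' {a b} := by
    have := layer_le hn a
    have := layer_le hn b
    simp only [layered_adj, Fin.revPerm_apply, layer_rev hn, ne_eq, Fin.rev_inj]
    grind

/-- The vertices up to layer `m` are spanned by a path between any two vertices of layer `m`. -/
theorem spans_layer_le (hn : n = 3 * N + 1) (m : ℕ) (hm : m < N) {s t : Fin n} (hst : s ≠ t)
    (hs : layer s = m) (ht : layer t = m) : (layered n N).Spans {w | layer w ≤ m} s t := by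
  induction m using Nat.twoStepInduction generalizing s t with
  | zero =>
    obtain ⟨t', hst', h⟩ := exists_layer_eq_pair hn hm hs (.inl rfl)
    obtain rfl : t = t' := by grind
    refine ((Spans.singleton s).append ?_ (Spans.singleton t) ?_).congr ?_
    · grind [layered_adj]
    · grind
    · grind
  | one =>
    obtain ⟨r, hsr, htr, h⟩ := exists_layer_eq_triple_of_layer_pair hn hs ht hst one_pos hm
    obtain ⟨v, huv, h0⟩ := exists_layer_eq_pair (a := (⟨0, by omega⟩ : Fin n)) hn
      (by omega) (by simp [layer]) (.inl rfl)
    generalize (⟨0, by omega⟩ : Fin n) = u at huv h0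
    have hu : layer u = 0 := by grind
    have hv : layer v = 0 := by grind
    have hr : layer r = 1 := by grind
    refine (((((Spans.singleton s).append (w := u) ?_ (Spans.singleton u) ?_).append
      (w := r) ?_ (Spans.singleton r) ?_).append (w := v) ?_ (Spans.singleton v) ?_).append
      (w := t) ?_ (Spans.singleton t) ?_).congr ?_
    all_goals grind [layered_adj]
  | more m ih ih' =>
    obtain ⟨r, hsr, htr, h⟩ :=
      exists_layer_eq_triple_of_layer_pair hn hs ht hst (by omega) hm
    obtain ⟨a, b, c, hab, hac, hbc, h'⟩ :=
      exists_layer_eq_triple (m := m + 1) hn (by omega) (by omega)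
    obtain ⟨a', b', hab', ha', hb'⟩ := exists_pair_layer_eq hn (by omega) (m := m) (by omega)
    have hcap := ih (by omega) hab' ha' hb'
    clear ih ih'
    have hr : layer r = m + 2 := by grind
    have ha : layer a = m + 1 := by grind
    have hb : layer b = m + 1 := by grind
    have hc : layer c = m + 1 := by grind
    refine (((((((Spans.singleton s).append (w := c) ?_ (Spans.singleton c) ?_).append
      (w := r) ?_ (Spans.singleton r) ?_).append (w := a) ?_ (Spans.singleton a) ?_).append ?_
      hcap ?_).append (w := b) ?_ (Spans.singleton b) ?_).append
      (w := t) ?_ (Spans.singleton t) ?_).congr ?_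
    rotate_right
    · intro w
      have hw := h w
      have hw' := h' w
      clear h h' hcap
      simp only [Set.mem_union, Set.mem_singleton_iff, Set.mem_ofPred_eq]
      grind
    all_goals grind [layered_adj]

/-- The vertices from layer `m` on are spanned by a path between any two vertices of layer `m`. -/
theorem spans_le_layer (hn : n = 3 * N + 1) (m : ℕ) (hm : 0 < m) {s t : Fin n} (hst : s ≠ t)
    (hs : layer s = m) (ht : layer t = m) : (layered n N).Spans {w | m ≤ layer w} s t := by
  have hmN := layer_le hn s
  have h := (spans_layer_le hn (N - m) (by omega) (Fin.rev_injective.ne hst)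
    (by rw [layer_rev hn, hs]) (by rw [layer_rev hn, ht])).map (layeredRev hn)
  change Spans _ _ s.rev.rev t.rev.rev at h
  rw [Fin.rev_rev, Fin.rev_rev] at h
  refine h.congr fun w ↦ ?_
  have hw := layer_le hn w
  have hw' := layer_rev hn w
  constructor
  · rintro ⟨z, hz, rfl⟩
    change layer z ≤ N - m at hz
    change m ≤ layer z.rev
    have := layer_rev hn z
    omega
  · intro h
    refine ⟨w.rev, ?_, Fin.rev_rev w⟩
    change m ≤ layer w at h
    change layer w.rev ≤ N - m
    omega

/-- The vertices up to layer `m` split into a path from `x` to layer `m` and a path with both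
ends in layer `m`. -/
theorem exists_two_spans_layer_le (hn : n = 3 * N + 1) (x : Fin n) (m : ℕ) (hxm : layer x ≤ m)
    (hm : m < N) :
    ∃ (p q r : Fin n) (S T : Set (Fin n)), layer p = m ∧ layer q = m ∧ layer r = m ∧
      (∀ w ∈ S, w ∉ T) ∧ (∀ w, layer w ≤ m ↔ w ∈ S ∨ w ∈ T) ∧
      (layered n N).Spans S x p ∧ (layered n N).Spans T q r := by
  induction m, hxm using Nat.le_induction with
  | base =>
    rcases Nat.eq_zero_or_pos (layer x) with h0 | h0
    · obtain ⟨v, hxv, h⟩ := exists_layer_eq_pair hn (by omega) h0 (.inl rfl)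
      refine ⟨x, v, v, {x}, {v}, ?_, ?_, ?_, ?_, ?_, Spans.singleton x, Spans.singleton v⟩
      all_goals grind
    · obtain ⟨y, z, hxy, hxz, hyz, h⟩ := exists_layer_eq_triple_of_layer hn rfl h0 hm
      obtain ⟨s, t, hst, hs, ht⟩ := exists_pair_layer_eq hn (by omega) (m := layer x - 1) (by omega)
      refine ⟨y, z, z, _, {z}, ?_, ?_, ?_, ?_, ?_, ((Spans.singleton x).append ?_
        (spans_layer_le hn _ (by omega) hst hs ht) ?_).append
          ?_ (Spans.singleton y) ?_, Spans.singleton z⟩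
      all_goals grind [layered_adj]
  | succ m hxm ih =>
    obtain ⟨p, q, r, S, T, hp, hq, hr, hd, hu, h₁, h₂⟩ := ih (by omega)
    obtain ⟨a, b, c, hab, hac, hbc, h⟩ :=
      exists_layer_eq_triple (m := m + 1) hn (by omega) hm
    have ha : layer a = m + 1 := by grind
    have hb : layer b = m + 1 := by grind
    have hc : layer c = m + 1 := by grind
    refine ⟨a, b, c, _, _, ha, hb, hc, ?_, ?_, h₁.append ?_ (Spans.singleton a) ?_,
      ((Spans.singleton b).append ?_ h₂ ?_).append ?_ (Spans.singleton c) ?_⟩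
    all_goals grind [layered_adj]

theorem spans_univ_of_layer_lt (hn : n = 3 * N + 1) {x y : Fin n} (h : layer x < layer y) :
    (layered n N).Spans Set.univ x y := by
  have hyN := layer_le hn y
  obtain ⟨p, q, r, S, T, hp, hq, hr, hd, hu, h₁, h₂⟩ :=
    exists_two_spans_layer_le hn x (layer y - 1) (by omega) (by omega)
  rcases hyN.eq_or_lt with hy | hy
  · obtain ⟨z, hyz, h'⟩ := exists_layer_eq_pair hn (by omega) hy (.inr rfl)
    have hw := layer_le hn
    refine (((h₁.append (w := z) ?_ (Spans.singleton z) ?_).append ?_ h₂ ?_).append ?_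
      (Spans.singleton y) ?_).congr ?_
    all_goals grind [layered_adj]
  · obtain ⟨a, b, hya, hyb, hab, h'⟩ := exists_layer_eq_triple_of_layer hn rfl (by omega) hy
    obtain ⟨s, t, hst, hs, ht⟩ := exists_pair_layer_eq hn (by omega) (m := layer y + 1) hy
    refine (((((h₁.append (w := b) ?_ (Spans.singleton b) ?_).append ?_ h₂ ?_).append (w := a) ?_
      (Spans.singleton a) ?_).append ?_ (spans_le_layer hn _ (by omega) hst hs ht) ?_).append ?_
      (Spans.singleton y) ?_).congr ?_
    all_goals grind [layered_adj]

theorem spans_univ_of_layer_eq (hn : n = 3 * N + 1) (hN : 0 < N) {x y : Fin n} (hxy : x ≠ y)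
    (h : layer x = layer y) : (layered n N).Spans Set.univ x y := by
  have hw := layer_le hn
  rcases (hw x).eq_or_lt with hx | hx
  · obtain ⟨z, hxz, h'⟩ := exists_layer_eq_pair hn hN hx (.inr rfl)
    obtain ⟨s, t, hst, hs, ht⟩ := exists_pair_layer_eq hn (by omega) (m := N - 1) (by omega)
    refine (((Spans.singleton x).append ?_ (spans_layer_le hn _ (by omega) hst hs ht) ?_).append
      ?_ (Spans.singleton y) ?_).congr ?_
    all_goals grind [layered_adj]
  obtain ⟨s, t, hst, hs, ht⟩ := exists_pair_layer_eq hn (by omega) (m := layer x + 1) hx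
  have hcap := spans_le_layer hn _ (by omega) hst hs ht
  rcases Nat.eq_zero_or_pos (layer x) with h0 | h0
  · obtain ⟨z, hxz, h'⟩ := exists_layer_eq_pair hn hN h0 (.inl rfl)
    refine (((Spans.singleton x).append ?_ hcap ?_).append ?_ (Spans.singleton y) ?_).congr ?_
    all_goals grind [layered_adj]
  · obtain ⟨z, hxz, hyz, h'⟩ :=
      exists_layer_eq_triple_of_layer_pair hn rfl h.symm hxy h0 hx
    obtain ⟨s', t', hst', hs', ht'⟩ :=
      exists_pair_layer_eq hn (by omega) (m := layer x - 1) (by omega)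
    refine (((((Spans.singleton x).append ?_
      (spans_layer_le hn _ (by omega) hst' hs' ht') ?_).append (w := z) ?_ (Spans.singleton z)
      ?_).append ?_ hcap ?_).append ?_ (Spans.singleton y) ?_).congr ?_
    all_goals grind [layered_adj]

theorem hamiltonianConnected_layered (hn : n = 3 * N + 1) (hN : 0 < N) :
    (layered n N).HamiltonianConnected := by
  intro u v huv
  obtain ⟨p, hp, h⟩ : (layered n N).Spans Set.univ u v := by
    rcases lt_trichotomy (layer u) (layer v) with h | h | h
    · exact spans_univ_of_layer_lt hn h
    · exact spans_univ_of_layer_eq hn hN huv h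
    · exact (spans_univ_of_layer_lt hn h).symm
  exact ⟨p, hp, fun w ↦ (h w).2 trivial⟩

/-- A walk to `v` in layer `0` that avoids all other vertices of that layer has the parity
prescribed by the layers, unless it visits layer `N`. -/
theorem even_length_add_layer_or_le (hn : n = 3 * N + 1) {z v : Fin n} (hv : layer v = 0)
    (p : (layered n N).Walk z v) (hp : ∀ w ∈ p.support, layer w = 0 → w = v) :
    layer z ≤ p.length ∧ (Even (p.length + layer z) ∨ 2 * N + 1 ≤ p.length + layer z) := by
  induction p with
  | nil => simp [hv]
  | @cons a b c h q ih =>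
    have hb : b ∈ q.support := q.start_mem_support
    have := ih hv (by grind [Walk.support_cons])
    have := layer_le hn a
    have := layer_le hn b
    have ha := hp a (by simp)
    have hb := hp b (by simp)
    rw [layered_adj] at h
    rw [Walk.length_cons]
    grind

theorem not_hasPropP_layered (hn : n = 3 * N + 1) (hN : 0 < N) {i : ℕ} (hi : Even i)
    (h₂ : 2 < i) (hiN : i ≤ 2 * N) : ¬ (layered n N).HasPropP i := by
  intro hP
  obtain ⟨v, huv, hv⟩ := exists_layer_eq_pair (a := (⟨0, by omega⟩ : Fin n)) hn hN
    (m := 0) (by simp [layer]) (.inl rfl)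
  generalize (⟨0, by omega⟩ : Fin n) = u at huv hv
  obtain ⟨p, hp, hlen⟩ := hP u v huv
  cases p with
  | nil => exact huv rfl
  | @cons _ z _ h q =>
    rw [Walk.cons_isPath_iff] at hp
    have hz : z ∈ q.support := q.start_mem_support
    have hzv : z ≠ v := by
      rintro rfl
      have := Walk.length_eq_zero_iff.2 (Walk.isPath_iff_nil.1 hp.1)
      rw [Walk.length_cons] at hlen
      omega
    have := even_length_add_layer_or_le hn ((hv v).2 (.inr rfl)) q (by grind)
    rw [layered_adj] at h
    rw [Walk.length_cons] at hlen
    grind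

end layered

end SimpleGraph

/-- For every `k` there is a hamiltonian-connected graph on `16 + 6k` vertices
failing property `P i` for every even `i` with `4 ≤ i ≤ 10 + 4k`. -/
theorem exists_hamConnected_failing_many_propP (k : ℕ) :
    ∃ G : SimpleGraph (Fin (16 + 6 * k)),
      G.HamiltonianConnected ∧
      ∀ i : ℕ, Even i → 4 ≤ i → i ≤ 10 + 4 * k → ¬ G.HasPropP i := by
  refine ⟨.layered _ (5 + 2 * k), SimpleGraph.hamiltonianConnected_layered (by omega) (by omega),
    fun i hi h₄ hik ↦ ?_⟩
  exact SimpleGraph.not_hasPropP_layered (by omega) (by omega) hi (by omega) (by omega)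
end

section
/- For each integer k ≥ 2, the graph F_k is hamiltonian-connected. -/
/-- The graph `F_k` of the paper: `k` copies of the gadget `G_A` joined in a ring.
Vertex `(i, j)` represents the vertex `v_{i, j+1}` of the paper. -/
def Fgraph (k : ℕ) : SimpleGraph (ZMod k × Fin 6) :=
  SimpleGraph.fromEdgeSet
    (⋃ i : ZMod k,
      ({s((i, 0), (i, 1)), s((i, 1), (i, 2)), s((i, 3), (i, 4)), s((i, 4), (i, 5)),
        s((i, 0), (i, 4)), s((i, 1), (i, 3)), s((i, 2), (i, 5)),
        s((i, 2), (i + 1, 0)), s((i, 5), (i + 1, 3))} : Set (Sym2 (ZMod k × Fin 6))))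

namespace SimpleGraph

variable {V : Type*} {G : SimpleGraph V} {x y z : V} {s t : Set V} {m n : ℕ}

/-- There is a walk of length `n` from `x` to `y` visiting all of `s`. -/
def CoveringWalk (G : SimpleGraph V) (x y : V) (s : Set V) (n : ℕ) : Prop :=
  ∃ p : G.Walk x y, p.length = n ∧ ∀ w ∈ s, w ∈ p.support

theorem Adj.coveringWalk (h : G.Adj x y) : G.CoveringWalk x y {x, y} 1 :=
  ⟨h.toWalk, rfl, by simp⟩

namespace CoveringWalk

theorem refl (G : SimpleGraph V) (x : V) : G.CoveringWalk x x {x} 0 :=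
  ⟨.nil, rfl, by simp⟩

theorem symm (h : G.CoveringWalk x y s n) : G.CoveringWalk y x s n := by
  obtain ⟨p, hp, hs⟩ := h
  exact ⟨p.reverse, by simpa using hp, by simpa using hs⟩

theorem trans (h : G.CoveringWalk x y s m) (h' : G.CoveringWalk y z t n) :
    G.CoveringWalk x z (s ∪ t) (m + n) := by
  obtain ⟨p, rfl, hs⟩ := h
  obtain ⟨q, rfl, ht⟩ := h'
  refine ⟨p.append q, by simp, ?_⟩
  rintro w (hw | hw)
  · exact Walk.mem_support_append_iff _ _ |>.2 (.inl (hs w hw))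
  · exact Walk.mem_support_append_iff _ _ |>.2 (.inr (ht w hw))

theorem mono (h : G.CoveringWalk x y s n) (hts : t ⊆ s) : G.CoveringWalk x y t n := by
  obtain ⟨p, hp, hs⟩ := h
  exact ⟨p, hp, fun w hw => hs w (hts hw)⟩

/-- A walk with as many vertices as the graph and visiting all of them is a path. -/
theorem exists_isPath [Fintype V] (h : G.CoveringWalk x y s n) (hs : ∀ v, v ∈ s)
    (hn : n + 1 = Fintype.card V) :
    ∃ p : G.Walk x y, p.IsPath ∧ ∀ w : V, w ∈ p.support := by
  classical
  obtain ⟨p, rfl, hp⟩ := h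
  have hmem : ∀ w, w ∈ p.support := fun w => hp w (hs w)
  refine ⟨p, (p.isPath_def).2 ?_, hmem⟩
  rw [← Multiset.coe_nodup, ← Multiset.toFinset_card_eq_card_iff_nodup,
    Finset.eq_univ_of_forall (s := Multiset.toFinset _) (by simpa using hmem)]
  simp [← hn]

end CoveringWalk

end SimpleGraph

namespace Fgraph

open SimpleGraph

/-- The edges of one copy of the gadget, each in one orientation. -/
def gadgetEdges : List (Fin 6 × Fin 6) :=
  [(0, 1), (1, 2), (3, 4), (4, 5), (0, 4), (1, 3), (2, 5)]

/-- The pairs of ports through which a copy is joined to the next one. -/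
def portEdges : List (Fin 6 × Fin 6) := [(2, 0), (5, 3)]

/-- The upper row `{0, 1, 2}` and the lower row `{3, 4, 5}` of the gadget. -/
def row (b : Fin 2) : Set (Fin 6) := {j | j.val / 3 = b.val}

section Arcs

variable {k : ℕ}

theorem adj_of_mem_gadgetEdges (a : ZMod k) {i j : Fin 6} (h : (i, j) ∈ gadgetEdges) :
    (Fgraph k).Adj (a, i) (a, j) := by
  simp only [Fgraph, fromEdgeSet_adj, Set.mem_iUnion]
  simp only [gadgetEdges, List.mem_cons, Prod.mk.injEq, List.not_mem_nil, or_false] at h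
  refine ⟨⟨a, ?_⟩, ?_⟩ <;> rcases h with h | h | h | h | h | h | h <;> simp [h]

theorem adj_of_mem_portEdges (a : ZMod k) {i j : Fin 6} (h : (i, j) ∈ portEdges) :
    (Fgraph k).Adj (a, i) (a + 1, j) := by
  simp only [Fgraph, fromEdgeSet_adj, Set.mem_iUnion]
  simp only [portEdges, List.mem_cons, Prod.mk.injEq, List.not_mem_nil, or_false] at h
  refine ⟨⟨a, ?_⟩, ?_⟩ <;> rcases h with h | h <;> simp [h]

/-- The vertices with second coordinate in `J` of the `n` copies following copy `a`. -/
def arc (a : ZMod k) (n : ℕ) (J : Set (Fin 6)) : Set (ZMod k × Fin 6) :=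
  {v | ∃ i < n, v.1 = a + i + 1 ∧ v.2 ∈ J}

theorem gadget_upper (a : ZMod k) :
    (Fgraph k).CoveringWalk (a, 0) (a, 2) ({a} ×ˢ row 0) 2 := by
  refine ⟨.cons (adj_of_mem_gadgetEdges a (j := 1) (by decide))
    (.cons (adj_of_mem_gadgetEdges a (by decide)) .nil), rfl, ?_⟩
  rintro ⟨b, j⟩ ⟨rfl, hj⟩
  fin_cases j <;> simp_all [row]

theorem gadget_lower (a : ZMod k) :
    (Fgraph k).CoveringWalk (a, 3) (a, 5) ({a} ×ˢ row 1) 2 := by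
  refine ⟨.cons (adj_of_mem_gadgetEdges a (j := 4) (by decide))
    (.cons (adj_of_mem_gadgetEdges a (by decide)) .nil), rfl, ?_⟩
  rintro ⟨b, j⟩ ⟨rfl, hj⟩
  fin_cases j <;> simp_all [row]

theorem gadget_single_upper (a : ZMod k) :
    (Fgraph k).CoveringWalk (a, 0) (a, 2) ({a} ×ˢ Set.univ) 5 := by
  refine ⟨.cons (adj_of_mem_gadgetEdges a (j := 1) (by decide))
    (.cons (adj_of_mem_gadgetEdges a (j := 3) (by decide))
    (.cons (adj_of_mem_gadgetEdges a (j := 4) (by decide))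
    (.cons (adj_of_mem_gadgetEdges a (j := 5) (by decide))
    (.cons (adj_of_mem_gadgetEdges a (by decide)).symm .nil)))), rfl, ?_⟩
  rintro ⟨b, j⟩ ⟨rfl, -⟩
  fin_cases j <;> simp

theorem gadget_single_lower (a : ZMod k) :
    (Fgraph k).CoveringWalk (a, 3) (a, 5) ({a} ×ˢ Set.univ) 5 := by
  refine ⟨.cons (adj_of_mem_gadgetEdges a (j := 4) (by decide))
    (.cons (adj_of_mem_gadgetEdges a (i := 0) (by decide)).symm
    (.cons (adj_of_mem_gadgetEdges a (j := 1) (by decide))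
    (.cons (adj_of_mem_gadgetEdges a (j := 2) (by decide))
    (.cons (adj_of_mem_gadgetEdges a (by decide)) .nil)))), rfl, ?_⟩
  rintro ⟨b, j⟩ ⟨rfl, -⟩
  fin_cases j <;> simp

theorem gadget_turn (a : ZMod k) :
    (Fgraph k).CoveringWalk (a, 0) (a, 3) ({a} ×ˢ Set.univ) 5 := by
  refine ⟨.cons (adj_of_mem_gadgetEdges a (j := 1) (by decide))
    (.cons (adj_of_mem_gadgetEdges a (j := 2) (by decide))
    (.cons (adj_of_mem_gadgetEdges a (j := 5) (by decide))
    (.cons (adj_of_mem_gadgetEdges a (i := 4) (by decide)).symm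
    (.cons (adj_of_mem_gadgetEdges a (by decide)).symm .nil)))), rfl, ?_⟩
  rintro ⟨b, j⟩ ⟨rfl, -⟩
  fin_cases j <;> simp

/-- Walks through single copies concatenate to a walk through an arc. -/
theorem coveringWalk_arc {i j : Fin 6} (hij : (i, j) ∈ portEdges) {J : Set (Fin 6)} {l : ℕ}
    (h : ∀ a : ZMod k, (Fgraph k).CoveringWalk (a, j) (a, i) ({a} ×ˢ J) l)
    (a : ZMod k) (n : ℕ) :
    (Fgraph k).CoveringWalk (a, i) (a + n + 1, j) (arc a n J) ((l + 1) * n + 1) := by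
  induction n with
  | zero =>
    have := (adj_of_mem_portEdges a hij).coveringWalk.mono (Set.empty_subset _)
    simpa [arc] using this
  | succ n ih =>
    have := (ih.trans (h _)).trans (adj_of_mem_portEdges (a + (n : ZMod k) + 1) hij).coveringWalk
    have e : (l + 1) * n + 1 + l + 1 = (l + 1) * (n + 1) + 1 := by ring
    rw [e] at this
    push_cast
    rw [← add_assoc a]
    refine this.mono ?_
    rintro ⟨b, c⟩ ⟨q, hq, rfl, hc⟩
    rcases Nat.lt_succ_iff_lt_or_eq.1 hq with hq | rfl
    · exact .inl (.inl ⟨q, hq, rfl, hc⟩)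
    · exact .inl (.inr ⟨rfl, hc⟩)

theorem arc_univ_eq (a : ZMod k) (n : ℕ) :
    arc a n Set.univ = arc a n (row 0) ∪ arc a n (row 1) := by
  ext ⟨b, j⟩
  have : j ∈ row 0 ∨ j ∈ row 1 := by fin_cases j <;> simp [row]
  constructor
  · rintro ⟨q, hq, hb, -⟩
    exact this.imp (fun h => ⟨q, hq, hb, h⟩) (fun h => ⟨q, hq, hb, h⟩)
  · rintro (⟨q, hq, hb, -⟩ | ⟨q, hq, hb, -⟩) <;> exact ⟨q, hq, hb, trivial⟩

/-- An arc can be traversed by entering and leaving it at the same end. -/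
theorem coveringWalk_arc_turn (a : ZMod k) (n : ℕ) :
    (Fgraph k).CoveringWalk (a, 2) (a, 5) (arc a n Set.univ) (6 * n + 1) := by
  cases n with
  | zero =>
    have := (adj_of_mem_gadgetEdges a (i := 2) (j := 5) (by decide)).coveringWalk.mono
      (Set.empty_subset _)
    simpa [arc] using this
  | succ n =>
    have := ((coveringWalk_arc (by decide) gadget_upper a n).trans (gadget_turn _)).trans
      (coveringWalk_arc (by decide) gadget_lower a n).symm
    have e : (2 + 1) * n + 1 + 5 + ((2 + 1) * n + 1) = 6 * (n + 1) + 1 := by ring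
    rw [e] at this
    refine this.mono ?_
    rintro ⟨b, c⟩ ⟨q, hq, rfl, hc⟩
    rcases Nat.lt_succ_iff_lt_or_eq.1 hq with hq | rfl
    · have : (a + (q : ZMod k) + 1, c) ∈ arc a n Set.univ := ⟨q, hq, rfl, hc⟩
      rw [arc_univ_eq] at this
      exact this.elim (fun h => .inl (.inl h)) .inr
    · exact .inl (.inr ⟨rfl, hc⟩)

end Arcs

section Templates

/-- How a path meets an arc of copies: it passes through all of it once, it passes through its two
rows separately, or it enters and leaves at the beginning of the arc. -/
inductive ArcMode
  | single
  | double
  | turn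

variable {r : ℕ} [NeZero r]

/-- In a ring of `r` copies with an arc of further copies inserted after each of them, the rows
of arcs visited when going from `x` to `y`; `none` if this is not a permitted step. -/
def orientedStep (μ : Fin r → ArcMode) (x y : Fin r × Fin 6) : Option (List (Fin r × Fin 2)) :=
  if x.1 = y.1 ∧ (x.2, y.2) ∈ gadgetEdges then
    match μ x.1, decide ((x.2, y.2) = (2, 5)) with
    | .turn, true => some [(x.1, 0), (x.1, 1)]
    | _, _ => some []
  else if y.1 = x.1 + 1 ∧ (x.2, y.2) ∈ portEdges then
    match μ x.1 with
    | .single => some [(x.1, 0), (x.1, 1)]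
    | .double => some [(x.1, if x.2 = 2 then 0 else 1)]
    | .turn => none
  else none

/-- The version of `orientedStep` in which edges may be used in both directions. -/
def step (μ : Fin r → ArcMode) (x y : Fin r × Fin 6) : Option (List (Fin r × Fin 2)) :=
  orientedStep μ x y <|> orientedStep μ y x

/-- The rows of arcs visited along a list of vertices. -/
def trace (μ : Fin r → ArcMode) : Fin r × Fin 6 → List (Fin r × Fin 6) →
    Option (List (Fin r × Fin 2))
  | _, [] => some []
  | x, y :: l => (step μ x y).bind fun s => (trace μ y l).map (s ++ ·)

/-- The list `x :: l` describes a hamiltonian path from `x` to `y`: it visits every vertex and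
every row of an arc exactly once. -/
def IsTemplate (μ : Fin r → ArcMode) (x y : Fin r × Fin 6) (l : List (Fin r × Fin 6)) : Prop :=
  l.getLast? = some y ∧ ((x :: l : List _) : Multiset (Fin r × Fin 6)) = Finset.univ.val ∧
    (trace μ x l).map Multiset.ofList = some Finset.univ.val

instance (μ : Fin r → ArcMode) (x y : Fin r × Fin 6) (l : List (Fin r × Fin 6)) :
    Decidable (IsTemplate μ x y l) :=
  inferInstanceAs (Decidable (_ ∧ _ ∧ _))

/-- A decomposition of the ring of `k` copies into `r` distinguished copies, each followed by an
arc of further copies. -/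
structure Layout (k r : ℕ) [NeZero r] where
  pos : Fin r → ZMod k
  gap : Fin r → ℕ
  pos_succ : ∀ c, pos (c + 1) = pos c + gap c + 1
  exists_eq : ∀ z, ∃ c, ∃ i ≤ gap c, z = pos c + i
  sum_gap : ∑ c, (gap c + 1) = k

namespace Layout

variable {k : ℕ} (L : Layout k r) {μ : Fin r → ArcMode}

/-- The vertex of `F_k` at a given vertex of the distinguished copies. -/
def vertex (x : Fin r × Fin 6) : ZMod k × Fin 6 := (L.pos x.1, x.2)

/-- The vertices in the given rows of arcs. -/
def cover (s : List (Fin r × Fin 2)) : Set (ZMod k × Fin 6) :=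
  {v | ∃ e ∈ s, v ∈ arc (L.pos e.1) (L.gap e.1) (row e.2)}

/-- The number of vertices in the given rows of arcs. -/
def size (s : List (Fin r × Fin 2)) : ℕ := (s.map fun e => 3 * L.gap e.1).sum

theorem cover_append (s t : List (Fin r × Fin 2)) :
    L.cover (s ++ t) = L.cover s ∪ L.cover t := by
  ext v
  simp [cover, or_and_right, exists_or]

theorem cover_both (c : Fin r) :
    L.cover [(c, 0), (c, 1)] = arc (L.pos c) (L.gap c) Set.univ := by
  rw [arc_univ_eq]
  ext v
  simp [cover]

theorem coveringWalk_orientedStep {x y : Fin r × Fin 6} {s : List (Fin r × Fin 2)}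
    (h : orientedStep μ x y = some s) :
    (Fgraph k).CoveringWalk (L.vertex x) (L.vertex y) (L.cover s) (L.size s + 1) := by
  obtain ⟨c, i⟩ := x
  obtain ⟨d, j⟩ := y
  have both : L.size [(c, 0), (c, 1)] + 1 = 6 * L.gap c + 1 := by simp [size]; ring
  unfold orientedStep at h
  split at h
  · rename_i h₁
    obtain ⟨rfl, hij⟩ := h₁
    split at h
    · rename_i h25
      obtain ⟨rfl, rfl⟩ : i = 2 ∧ j = 5 := by simpa using h25
      obtain rfl := Option.some.inj h
      rw [cover_both, both]
      exact coveringWalk_arc_turn _ _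
    · obtain rfl := Option.some.inj h
      simpa [size, vertex] using (adj_of_mem_gadgetEdges (L.pos c) hij).coveringWalk.mono
        (t := L.cover []) (by simp [cover])
  · split at h
    · rename_i h₂
      obtain ⟨rfl, hij⟩ := h₂
      simp only [vertex, L.pos_succ]
      have hij' : i = 2 ∧ j = 0 ∨ i = 5 ∧ j = 3 := by simpa [portEdges] using hij
      split at h
      · obtain rfl := Option.some.inj h
        rw [cover_both, both]
        rcases hij' with ⟨rfl, rfl⟩ | ⟨rfl, rfl⟩
        · exact coveringWalk_arc hij gadget_single_upper _ _
        · exact coveringWalk_arc hij gadget_single_lower _ _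
      · obtain rfl := Option.some.inj h
        rcases hij' with ⟨rfl, rfl⟩ | ⟨rfl, rfl⟩
        · simpa [cover, size] using coveringWalk_arc hij gadget_upper (L.pos c) (L.gap c)
        · simpa [cover, size] using coveringWalk_arc hij gadget_lower (L.pos c) (L.gap c)
      · simp at h
    · simp at h

theorem coveringWalk_step {x y : Fin r × Fin 6} {s : List (Fin r × Fin 2)}
    (h : step μ x y = some s) :
    (Fgraph k).CoveringWalk (L.vertex x) (L.vertex y) (L.cover s) (L.size s + 1) := by
  rcases (Option.orElse_eq_some _ _ _).1 h with h | ⟨-, h⟩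
  · exact L.coveringWalk_orientedStep h
  · exact (L.coveringWalk_orientedStep h).symm

theorem coveringWalk_trace {x : Fin r × Fin 6} {l : List (Fin r × Fin 6)}
    {s : List (Fin r × Fin 2)} (h : trace μ x l = some s) :
    (Fgraph k).CoveringWalk (L.vertex x) (L.vertex (l.getLast?.getD x))
      ({v | ∃ w ∈ x :: l, v = L.vertex w} ∪ L.cover s) (L.size s + l.length) := by
  induction l generalizing x s with
  | nil =>
    obtain rfl := Option.some.inj h
    simpa [size, cover] using CoveringWalk.refl (Fgraph k) (L.vertex x)
  | cons y l ih =>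
    obtain ⟨a, ha, h⟩ := Option.bind_eq_some_iff.1 h
    obtain ⟨b, hb, rfl⟩ := Option.map_eq_some_iff.1 h
    have := ((CoveringWalk.refl _ _).trans (L.coveringWalk_step ha)).trans (ih hb)
    have hlast : (y :: l).getLast?.getD x = l.getLast?.getD y := by
      rw [List.getLast?_cons, Option.getD_some]
    have e : 0 + (L.size a + 1) + (L.size b + l.length) =
        L.size (a ++ b) + (y :: l).length := by simp [size]; ring
    rw [hlast, ← e]
    refine this.mono ?_
    rw [cover_append]
    rintro v (⟨w, hw, rfl⟩ | hv | hv)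
    · rcases List.mem_cons.1 hw with rfl | hw
      · exact .inl (.inl rfl)
      · exact .inr (.inl ⟨w, hw, rfl⟩)
    · exact .inl (.inr hv)
    · exact .inr (.inr hv)

theorem exists_isPath [NeZero k] {x y : Fin r × Fin 6} {l : List (Fin r × Fin 6)}
    (h : IsTemplate μ x y l) :
    ∃ p : (Fgraph k).Walk (L.vertex x) (L.vertex y), p.IsPath ∧ ∀ w, w ∈ p.support := by
  obtain ⟨hy, hl, hs⟩ := h
  obtain ⟨s, hs, hs'⟩ := Option.map_eq_some_iff.1 hs
  have hwalk := L.coveringWalk_trace hs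
  rw [hy, Option.getD_some] at hwalk
  refine hwalk.exists_isPath ?_ ?_
  · rintro ⟨z, j⟩
    obtain ⟨c, i, hi, rfl⟩ := L.exists_eq z
    cases i with
    | zero =>
      have : (c, j) ∈ ((x :: l : List _) : Multiset (Fin r × Fin 6)) := by simp [hl]
      exact .inl ⟨(c, j), this, by simp [vertex]⟩
    | succ i =>
      obtain ⟨b, hb⟩ : ∃ b, j ∈ row b := by
        refine ⟨⟨j.val / 3, by omega⟩, rfl⟩
      have : (c, b) ∈ (s : Multiset (Fin r × Fin 2)) := by simp [hs']
      exact .inr ⟨(c, b), this, i, hi, by push_cast; ring, hb⟩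
  · have hsize : L.size s = ∑ e : Fin r × Fin 2, 3 * L.gap e.1 := by
      rw [Finset.sum, ← hs']
      simp [size]
    have hlen := congrArg Multiset.card hl
    have hk := L.sum_gap
    simp only [Multiset.coe_card, List.length_cons, Finset.card_val, Finset.card_univ,
      Fintype.card_prod, Fintype.card_fin] at hlen
    rw [Finset.sum_add_distrib] at hk
    simp only [Finset.sum_const, Finset.card_univ, Fintype.card_fin, smul_eq_mul, mul_one] at hk
    rw [hsize, Fintype.sum_prod_type]
    simp only [Finset.sum_const, Finset.card_univ, Fintype.card_fin, smul_eq_mul,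
      Fintype.card_prod, ZMod.card, ← Finset.mul_sum]
    omega

/-- The layout with one distinguished copy. -/
def one [NeZero k] (a : ZMod k) : Layout k 1 where
  pos _ := a
  gap _ := k - 1
  pos_succ _ := by
    rw [Nat.cast_pred (NeZero.pos k)]
    simp
  exists_eq z := ⟨0, (z - a).val, Nat.le_pred_of_lt (ZMod.val_lt _), by simp⟩
  sum_gap := by
    have := NeZero.pos k
    simp only [Finset.univ_unique, Finset.sum_const, Finset.card_singleton, smul_eq_mul]
    omega

/-- The layout with two distinguished copies. -/
def two [NeZero k] (a b : ZMod k) (hab : a ≠ b) : Layout k 2 where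
  pos := ![a, b]
  gap := ![(b - a).val - 1, (a - b).val - 1]
  pos_succ c := by
    have h₁ : 0 < (b - a).val := ZMod.val_pos.2 (sub_ne_zero.2 hab.symm)
    have h₂ : 0 < (a - b).val := ZMod.val_pos.2 (sub_ne_zero.2 hab)
    fin_cases c
    · simp [Nat.cast_pred h₁, sub_add_cancel, add_assoc]
    · simp [Nat.cast_pred h₂, sub_add_cancel, add_assoc]
  exists_eq z := by
    have h₁ : 0 < (b - a).val := ZMod.val_pos.2 (sub_ne_zero.2 hab.symm)
    have h₂ : (a - b).val = k - (b - a).val := by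
      rw [← neg_sub, ZMod.neg_val, if_neg (sub_ne_zero.2 hab.symm)]
    have hz := ZMod.val_lt (z - a)
    by_cases h : (z - a).val < (b - a).val
    · exact ⟨0, (z - a).val, Nat.le_pred_of_lt h, by simp⟩
    · refine ⟨1, (z - a).val - (b - a).val, ?_, ?_⟩
      · simp only [Matrix.cons_val_one, Matrix.cons_val_fin_one]
        omega
      · rw [Nat.cast_sub (not_lt.1 h)]
        simp
  sum_gap := by
    have h₁ : 0 < (b - a).val := ZMod.val_pos.2 (sub_ne_zero.2 hab.symm)
    have h₂ : (a - b).val = k - (b - a).val := by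
      rw [← neg_sub, ZMod.neg_val, if_neg (sub_ne_zero.2 hab.symm)]
    have hz := ZMod.val_lt (b - a)
    simp only [Fin.sum_univ_two, Matrix.cons_val_zero, Matrix.cons_val_one,
      Matrix.cons_val_fin_one]
    omega

end Layout

/-- Vertex `j` of copy `c` is encoded as the number `6 * c + j`. -/
def decode (r : ℕ) [NeZero r] (l : List ℕ) : List (Fin r × Fin 6) :=
  l.map fun n => (Fin.ofNat r (n / 6), Fin.ofNat 6 n)

/-- Templates for the paths between vertices `i < j` of one copy. -/
def sameCopyTemplate : ℕ → ℕ → (Fin 1 → ArcMode) × List ℕ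
  | 0, 1 => (![.single], [0, 4, 3, 5, 2, 1])
  | 0, 2 => (![.single], [0, 4, 5, 3, 1, 2])
  | 0, 3 => (![.turn], [0, 1, 2, 5, 4, 3])
  | 0, 4 => (![.single], [0, 1, 2, 5, 3, 4])
  | 0, 5 => (![.single], [0, 2, 1, 3, 4, 5])
  | 1, 2 => (![.single], [1, 0, 4, 3, 5, 2])
  | 1, 3 => (![.single], [1, 0, 2, 5, 4, 3])
  | 1, 4 => (![.double], [1, 0, 2, 5, 3, 4])
  | 1, 5 => (![.single], [1, 3, 4, 0, 2, 5])
  | 2, 3 => (![.single], [2, 1, 0, 4, 5, 3])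
  | 2, 4 => (![.single], [2, 5, 3, 1, 0, 4])
  | 2, 5 => (![.single], [2, 1, 0, 4, 3, 5])
  | 3, 4 => (![.single], [3, 1, 0, 2, 5, 4])
  | 3, 5 => (![.single], [3, 1, 2, 0, 4, 5])
  | 4, 5 => (![.single], [4, 3, 1, 0, 2, 5])
  | _, _ => (![.single], [])

/-- Templates for the paths between vertices `i ≤ j` of two distinct copies. -/
def twoCopiesTemplate : ℕ → ℕ → (Fin 2 → ArcMode) × List ℕ
  | 0, 0 => (![.single, .turn], [0, 4, 3, 1, 2, 5, 9, 10, 11, 8, 7, 6])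
  | 0, 1 => (![.double, .single], [0, 1, 2, 6, 10, 9, 5, 4, 3, 11, 8, 7])
  | 0, 2 => (![.single, .turn], [0, 1, 3, 4, 5, 2, 6, 7, 9, 10, 11, 8])
  | 0, 3 => (![.single, .turn], [0, 1, 3, 4, 5, 2, 6, 7, 8, 11, 10, 9])
  | 0, 4 => (![.double, .single], [0, 1, 2, 6, 7, 8, 11, 3, 4, 5, 9, 10])
  | 0, 5 => (![.single, .turn], [0, 1, 3, 4, 5, 2, 6, 10, 9, 7, 8, 11])
  | 1, 1 => (![.single, .double], [1, 0, 8, 11, 3, 4, 5, 2, 6, 10, 9, 7])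
  | 1, 2 => (![.single, .double], [1, 2, 5, 9, 7, 6, 10, 11, 3, 4, 0, 8])
  | 1, 3 => (![.single, .double], [1, 0, 8, 7, 6, 2, 5, 4, 3, 11, 10, 9])
  | 1, 4 => (![.single, .double], [1, 0, 8, 11, 3, 4, 5, 2, 6, 7, 9, 10])
  | 1, 5 => (![.single, .double], [1, 0, 8, 7, 9, 10, 6, 2, 5, 4, 3, 11])
  | 2, 2 => (![.single, .double], [2, 1, 3, 11, 10, 6, 7, 9, 5, 4, 0, 8])
  | 2, 3 => (![.single, .double], [2, 1, 0, 8, 7, 6, 10, 11, 3, 4, 5, 9])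
  | 2, 4 => (![.single, .double], [2, 1, 0, 8, 11, 3, 4, 5, 9, 7, 6, 10])
  | 2, 5 => (![.single, .double], [2, 1, 0, 8, 7, 6, 10, 9, 5, 4, 3, 11])
  | 3, 3 => (![.single, .turn], [3, 1, 0, 4, 5, 2, 6, 7, 8, 11, 10, 9])
  | 3, 4 => (![.double, .single], [3, 4, 5, 9, 7, 6, 2, 1, 0, 8, 11, 10])
  | 3, 5 => (![.single, .turn], [3, 4, 0, 1, 2, 5, 9, 10, 6, 7, 8, 11])
  | 4, 4 => (![.single, .double], [4, 3, 11, 8, 0, 1, 2, 5, 9, 7, 6, 10])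
  | 4, 5 => (![.single, .double], [4, 5, 2, 6, 10, 9, 7, 8, 0, 1, 3, 11])
  | 5, 5 => (![.single, .double], [5, 4, 0, 8, 7, 9, 10, 6, 2, 1, 3, 11])
  | _, _ => (![.single, .single], [])

set_option maxRecDepth 100000 in
theorem isTemplate_sameCopy : ∀ i j : Fin 6, i < j →
    IsTemplate (sameCopyTemplate i j).1 (0, i) (0, j)
      (decode 1 (sameCopyTemplate i j).2).tail := by
  decide

set_option maxRecDepth 100000 in
theorem isTemplate_twoCopies : ∀ i j : Fin 6, i ≤ j →
    IsTemplate (twoCopiesTemplate i j).1 (0, i) (1, j)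
      (decode 2 (twoCopiesTemplate i j).2).tail := by
  decide

end Templates

end Fgraph

/-- `F_k` is hamiltonian-connected. -/
theorem Fgraph_hamiltonianConnected (k : ℕ) (hk : 2 ≤ k) :
    (Fgraph k).HamiltonianConnected := by
  have : NeZero k := ⟨by omega⟩
  have key : ∀ (a b : ZMod k) (i j : Fin 6), i ≤ j → (a, i) ≠ (b, j) →
      ∃ p : (Fgraph k).Walk (a, i) (b, j), p.IsPath ∧ ∀ w, w ∈ p.support := by
    intro a b i j hij hne
    by_cases hab : a = b
    · subst hab
      have hlt : i < j := lt_of_le_of_ne hij fun h => hne (by rw [h])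
      exact (Fgraph.Layout.one a).exists_isPath (Fgraph.isTemplate_sameCopy i j hlt)
    · exact (Fgraph.Layout.two a b hab).exists_isPath (Fgraph.isTemplate_twoCopies i j hij)
  rintro ⟨a, i⟩ ⟨b, j⟩ hne
  rcases le_total i j with hij | hij
  · exact key a b i j hij hne
  · obtain ⟨p, hp, hs⟩ := key b a j i hij hne.symm
    exact ⟨p.reverse, hp.reverse, by simpa using hs⟩
end
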